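/- arXiv:2108.02227 — 2 statements merged into one kernel-verified Lean document; each statement's English description precedes it below -/
import Mathlib

section
/- Let c = 1 − (1 + log log 2)/(log 2). Then for Lebesgue-almost all α > 0, the inequality δ_min^{(α)}(N) ≥ (log N)^{2c} / N holds for infinitely many N. -/
open MeasureTheory Filter

/-- `log x`, read as `max {1, log x}`. -/
noncomputable def L (x : ℝ) : ℝ := max 1 (Real.log x)

/-- `log₂ x = log log x`, with the `max {1, ·}` convention. -/
noncomputable def LL (x : ℝ) : ℝ := L (L x)

/-- `lam` enumerates, in increasing order (for indices `k ≥ 1`), the spectrum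
`{α m² + n² : m, n ≥ 1}` of the rectangular billiard. -/
def IsSpectrumEnum (α : ℝ) (lam : ℕ → ℝ) : Prop :=
  (∀ j k : ℕ, 1 ≤ j → j < k → lam j < lam k) ∧ 0 < lam 1 ∧
    {x : ℝ | ∃ k : ℕ, 1 ≤ k ∧ lam k = x} =
      {x : ℝ | ∃ m n : ℕ, 1 ≤ m ∧ 1 ≤ n ∧ x = α * (m : ℝ) ^ 2 + (n : ℝ) ^ 2}

/-- `δ_min^{(α)}(N) = min {λ_{k+1} − λ_k : 1 ≤ k ≤ N}`. -/
noncomputable def bDeltaMin (lam : ℕ → ℝ) (N : ℕ) : ℝ :=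
  sInf {x : ℝ | ∃ k : ℕ, 1 ≤ k ∧ k ≤ N ∧ x = lam (k + 1) - lam k}

/-- The constant from the Erdős multiplication table problem. -/
noncomputable def erdosC : ℝ := 1 - (1 + Real.log (Real.log 2)) / Real.log 2

open Finset in
theorem sum_le_sum_of_injOn {ι κ : Type*} {s : Finset ι} {t : Finset κ} (e : ι → κ)
    (hmem : ∀ x ∈ s, e x ∈ t) (hinj : Set.InjOn e s) {f : ι → ℝ} {g : κ → ℝ}
    (hfg : ∀ x ∈ s, f x ≤ g (e x)) (hg : ∀ y ∈ t, 0 ≤ g y) :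
    ∑ x ∈ s, f x ≤ ∑ y ∈ t, g y := by
  classical
  calc ∑ x ∈ s, f x ≤ ∑ x ∈ s, g (e x) := sum_le_sum hfg
    _ = ∑ y ∈ s.image e, g y := (sum_image hinj).symm
    _ ≤ ∑ y ∈ t, g y := sum_le_sum_of_subset_of_nonneg (image_subset_iff.2 hmem)
        fun y hy _ => hg y hy

theorem sum_primesLE_succ (g : ℕ → ℝ) (n : ℕ) :
    ∑ p ∈ (n + 1).primesLE, g p =
      (if (n + 1).Prime then g (n + 1) else 0) + ∑ p ∈ n.primesLE, g p := by
  rw [Nat.primesLE_succ]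
  split_ifs with h
  · rw [Finset.sum_insert (Nat.notMem_primesLE n)]
  · simp

theorem div_le_factorization_factorial {p : ℕ} (hp : p.Prime) (n : ℕ) :
    n / p ≤ (n.factorial).factorization p := by
  have h1 : (p * (n / p)).factorial ∣ n.factorial :=
    Nat.factorial_dvd_factorial (Nat.mul_div_le n p)
  have h2 := (Nat.factorization_le_iff_dvd (Nat.factorial_ne_zero _)
    (Nat.factorial_ne_zero _)).2 h1 p
  rw [Nat.factorization_factorial_mul hp] at h2
  omega

theorem sum_floor_mul_log_le_log_factorial (n : ℕ) :
    ∑ p ∈ n.primesLE, ((n / p : ℕ) : ℝ) * Real.log p ≤ Real.log n.factorial := by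
  rw [Real.log_nat_eq_sum_factorization, Finsupp.sum]
  refine sum_le_sum_of_injOn id ?_ (Set.injOn_id _) ?_ ?_
  · intro p hp
    rw [Nat.mem_primesLE] at hp
    rw [id, Nat.support_factorization, Nat.mem_primeFactors]
    exact ⟨hp.2, (hp.2.dvd_factorial).2 hp.1, Nat.factorial_ne_zero _⟩
  · intro p hp
    have := div_le_factorization_factorial (Nat.prime_of_mem_primesLE hp) n
    have h0 : 0 ≤ Real.log (p : ℝ) := Real.log_natCast_nonneg p
    simp only [id]
    gcongr
  · intro p _
    have h0 : 0 ≤ Real.log (p : ℝ) := Real.log_natCast_nonneg p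
    positivity

/-- Mertens' first theorem, upper bound. -/
theorem sum_log_div_prime_le {n : ℕ} (hn : 1 ≤ n) :
    ∑ p ∈ n.primesLE, Real.log p / p ≤ Real.log n + Real.log 4 := by
  have hn' : (0 : ℝ) < n := by exact_mod_cast hn
  have h1 : (n : ℝ) * ∑ p ∈ n.primesLE, Real.log p / p - ∑ p ∈ n.primesLE, Real.log p
      ≤ ∑ p ∈ n.primesLE, ((n / p : ℕ) : ℝ) * Real.log p := by
    rw [Finset.mul_sum, ← Finset.sum_sub_distrib]
    refine Finset.sum_le_sum fun p hp => ?_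
    have h0 : 0 ≤ Real.log (p : ℝ) := Real.log_natCast_nonneg p
    have h2 : (n : ℝ) / p < (n / p : ℕ) + 1 := by
      rw [← Nat.floor_div_eq_div (K := ℝ)]
      exact Nat.lt_floor_add_one _
    have h3 : (n : ℝ) * (Real.log p / p) = (n : ℝ) / p * Real.log p := by ring
    rw [h3]
    nlinarith
  have h2 : ∑ p ∈ n.primesLE, Real.log p ≤ Real.log 4 * n := by
    rw [← Chebyshev.theta_eq_sum_primesLE_log]
    exact Chebyshev.theta_le_log4_mul_x hn'.le
  have h3 : Real.log n.factorial ≤ n * Real.log n := by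
    rw [← Real.log_pow]
    refine Real.log_le_log (by exact_mod_cast Nat.factorial_pos n) ?_
    exact_mod_cast Nat.factorial_le_pow n
  have h4 := sum_floor_mul_log_le_log_factorial n
  have h5 : (n : ℝ) * ∑ p ∈ n.primesLE, Real.log p / p ≤ n * (Real.log n + Real.log 4) := by
    linarith
  exact le_of_mul_le_mul_left h5 hn'

/-- Mertens' second theorem, upper bound. -/
theorem exists_sum_one_div_prime_le :
    ∃ D : ℝ, 0 ≤ D ∧ ∀ n : ℕ, 2 ≤ n →
      ∑ p ∈ n.primesLE, (1 : ℝ) / p ≤ Real.log (Real.log n) + D := by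
  set c₀ : ℝ := 1 / 2 - Real.log (Real.log 2) + Real.log 4 / Real.log 2 with hc₀
  have key : ∀ n : ℕ, 2 ≤ n → ∑ p ∈ n.primesLE, (1 : ℝ) / p ≤
      (∑ p ∈ n.primesLE, Real.log p / p) / Real.log n + Real.log (Real.log n)
        - Real.log 4 / Real.log n + c₀ := by
    intro n hn
    induction n, hn using Nat.le_induction with
    | base =>
      have h2 : Nat.primesLE 2 = {2} := by decide
      have hl : 0 < Real.log 2 := Real.log_pos (by norm_num)
      rw [h2]
      simp only [Finset.sum_singleton, hc₀, Nat.cast_ofNat]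
      have : 0 ≤ Real.log 2 / 2 / Real.log 2 := by positivity
      linarith
    | succ n hn ih =>
      have hn1 : (1 : ℝ) < n := by exact_mod_cast hn
      have ha : 0 < Real.log n := Real.log_pos hn1
      have hb : 0 < Real.log ((n + 1 : ℕ) : ℝ) := Real.log_pos (by push_cast; linarith)
      have hab : Real.log n ≤ Real.log ((n + 1 : ℕ) : ℝ) :=
        Real.log_le_log (by linarith) (by push_cast; linarith)
      have hR := sum_log_div_prime_le (n := n) (by omega)
      rw [sum_primesLE_succ, sum_primesLE_succ]
      set R := ∑ p ∈ n.primesLE, Real.log p / p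
      set a := Real.log n
      set b := Real.log ((n + 1 : ℕ) : ℝ)
      have hstep : (if (n + 1).Prime then (1 : ℝ) / (n + 1 : ℕ) else 0) =
          (if (n + 1).Prime then b / (n + 1 : ℕ) else 0) / b := by
        split_ifs
        · field_simp
        · simp
      rw [hstep, add_div]
      have hlog : 1 - a / b ≤ Real.log b - Real.log a := by
        have := Real.one_sub_inv_le_log_of_pos (x := b / a) (by positivity)
        rw [Real.log_div hb.ne' ha.ne', inv_div] at this
        exact this
      have hinv : 0 ≤ 1 / a - 1 / b := by
        have := one_div_le_one_div_of_le ha hab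
        linarith
      have h1 : R * (1 / a - 1 / b) ≤ (a + Real.log 4) * (1 / a - 1 / b) :=
        mul_le_mul_of_nonneg_right hR hinv
      have h2 : (a + Real.log 4) * (1 / a - 1 / b) =
          1 - a / b + Real.log 4 / a - Real.log 4 / b := by
        field_simp
        ring
      have h3 : R * (1 / a - 1 / b) = R / a - R / b := by ring
      linarith
  refine ⟨max 0 (1 + c₀), le_max_left _ _, fun n hn => (key n hn).trans ?_⟩
  have hn1 : (1 : ℝ) < n := by exact_mod_cast hn
  have ha : 0 < Real.log n := Real.log_pos hn1
  have hR := sum_log_div_prime_le (n := n) (by omega)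
  have h1 : (∑ p ∈ n.primesLE, Real.log p / p) / Real.log n ≤ 1 + Real.log 4 / Real.log n := by
    rw [div_le_iff₀ ha, add_mul, div_mul_cancel₀ _ ha.ne']
    linarith
  have := le_max_right 0 (1 + c₀)
  linarith

theorem sum_log_div_sqrt_prime_le (n : ℕ) :
    ∑ p ∈ n.primesLE, Real.log p / √p ≤ 2 * Real.log 4 * √n := by
  have hθ : ∀ n : ℕ, ∑ p ∈ n.primesLE, Real.log p ≤ Real.log 4 * n := fun n => by
    rw [← Chebyshev.theta_eq_sum_primesLE_log]
    exact Chebyshev.theta_le_log4_mul_x n.cast_nonneg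
  have hl4 : 0 ≤ Real.log 4 := Real.log_nonneg (by norm_num)
  rcases Nat.eq_zero_or_pos n with rfl | hn
  · simp
  have key : ∀ n : ℕ, 1 ≤ n → ∑ p ∈ n.primesLE, Real.log p / √p ≤
      (∑ p ∈ n.primesLE, Real.log p) / √n + Real.log 4 * √n := by
    intro n hn
    induction n, hn using Nat.le_induction with
    | base => simp [hl4]
    | succ n hn ih =>
      have hn0 : (0 : ℝ) < n := by exact_mod_cast hn
      have hT := hθ n
      rw [sum_primesLE_succ, sum_primesLE_succ]
      set T := ∑ p ∈ n.primesLE, Real.log p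
      have hab : √(n : ℝ) ≤ √((n + 1 : ℕ) : ℝ) := Real.sqrt_le_sqrt (by push_cast; linarith)
      have ha : 0 < √(n : ℝ) := Real.sqrt_pos.2 hn0
      have haa : √(n : ℝ) * √(n : ℝ) = n := Real.mul_self_sqrt hn0.le
      set a := √(n : ℝ)
      set b := √((n + 1 : ℕ) : ℝ)
      have hb : 0 < b := ha.trans_le hab
      have hstep : (if (n + 1).Prime then Real.log ((n + 1 : ℕ) : ℝ) / b else 0) =
          (if (n + 1).Prime then Real.log ((n + 1 : ℕ) : ℝ) else 0) / b := by
        split_ifs <;> simp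
      rw [hstep, add_div]
      have hinv : 0 ≤ 1 / a - 1 / b := by
        have := one_div_le_one_div_of_le ha hab
        linarith
      have h1 : T * (1 / a - 1 / b) ≤ Real.log 4 * (a * a) * (1 / a - 1 / b) := by
        rw [haa]
        exact mul_le_mul_of_nonneg_right hT hinv
      have h2 : Real.log 4 * (a * a) * (1 / a - 1 / b) = Real.log 4 * (b - a) * (a / b) := by
        field_simp
      have h4 : Real.log 4 * (b - a) * (a / b) ≤ Real.log 4 * (b - a) :=
        mul_le_of_le_one_right (mul_nonneg hl4 (by linarith)) ((div_le_one hb).2 hab)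
      have h3 : T * (1 / a - 1 / b) = T / a - T / b := by ring
      linarith
  refine (key n hn).trans ?_
  have hn0 : (0 : ℝ) < √n := Real.sqrt_pos.2 (by exact_mod_cast hn)
  have h1 : (∑ p ∈ n.primesLE, Real.log p) / √n ≤ Real.log 4 * √n := by
    rw [div_le_iff₀ hn0, mul_assoc, Real.mul_self_sqrt n.cast_nonneg]
    exact hθ n
  linarith

/-- Squarefree `1 ≤ m ≤ X` with exactly `k` prime factors. -/
def sqfreeOmega (X k : ℕ) : Finset ℕ :=
  (Finset.Icc 1 X).filter fun m => Squarefree m ∧ m.primeFactors.card = k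

theorem mem_sqfreeOmega {X k m : ℕ} :
    m ∈ sqfreeOmega X k ↔ (1 ≤ m ∧ m ≤ X) ∧ Squarefree m ∧ m.primeFactors.card = k := by
  simp [sqfreeOmega]

/-- Removing one prime factor from a squarefree number. -/
theorem sum_sqfreeOmega_succ_le (X k : ℕ) {F : ℕ → ℕ → ℝ} (hF : ∀ m p, 0 ≤ F m p) :
    ∑ m ∈ sqfreeOmega X (k + 1), ∑ p ∈ m.primeFactors, F (m / p) p ≤
      ∑ m ∈ sqfreeOmega X k, ∑ p ∈ (X / m).primesLE, F m p := by
  rw [Finset.sum_sigma', Finset.sum_sigma']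
  refine sum_le_sum_of_injOn (fun x => ⟨x.1 / x.2, x.2⟩) ?_ ?_ (fun x _ => le_rfl)
    (fun y _ => hF _ _)
  · rintro ⟨m, p⟩ hx
    rw [Finset.mem_sigma, mem_sqfreeOmega, Nat.mem_primeFactors] at hx
    dsimp only at hx
    obtain ⟨⟨⟨h1, hX⟩, hsq, hk⟩, hp, ⟨q, rfl⟩, -⟩ := hx
    have hq : 0 < q := Nat.pos_of_ne_zero (by rintro rfl; simp at h1)
    have hcop : p.Coprime q := Nat.coprime_of_squarefree_mul hsq
    rw [hcop.primeFactors_mul, Finset.card_union_of_disjoint hcop.disjoint_primeFactors,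
      hp.primeFactors, Finset.card_singleton] at hk
    rw [Finset.mem_sigma, mem_sqfreeOmega, Nat.mem_primesLE]
    dsimp only
    rw [Nat.mul_div_cancel_left _ hp.pos]
    refine ⟨⟨⟨hq, ?_⟩, hsq.of_mul_right, by omega⟩, (Nat.le_div_iff_mul_le hq).2 hX, hp⟩
    exact (Nat.le_mul_of_pos_left q hp.pos).trans hX
  · rintro ⟨m, p⟩ hx ⟨m', p'⟩ hx' h
    simp only [Finset.coe_sigma, Set.mem_sigma_iff, Finset.mem_coe, Nat.mem_primeFactors]
      at hx hx'
    simp only [Sigma.mk.injEq, heq_eq_eq] at h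
    obtain ⟨h1, rfl⟩ := h
    rw [Nat.div_left_inj hx.2.2.1 hx'.2.2.1] at h1
    rw [h1]

theorem natCast_div_prime {m p : ℕ} (hp : p ∈ m.primeFactors) :
    ((m / p : ℕ) : ℝ) = (m : ℝ) / p :=
  Nat.cast_div (Nat.dvd_of_mem_primeFactors hp)
    (by exact_mod_cast (Nat.prime_of_mem_primeFactors hp).ne_zero)

theorem sum_one_div_sqfreeOmega_le {X : ℕ} {Q : ℝ}
    (hQ : ∑ p ∈ X.primesLE, (1 : ℝ) / p ≤ Q) (k : ℕ) :
    ∑ m ∈ sqfreeOmega X k, (1 : ℝ) / m ≤ Q ^ k / k.factorial := by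
  have hQ0 : 0 ≤ Q := le_trans (Finset.sum_nonneg fun p _ => by positivity) hQ
  induction k with
  | zero =>
    have : sqfreeOmega X 0 ⊆ {1} := by
      intro m hm
      rw [mem_sqfreeOmega, Finset.card_eq_zero, Nat.primeFactors_eq_empty] at hm
      simp; omega
    refine (Finset.sum_le_sum_of_subset_of_nonneg this fun _ _ _ => by positivity).trans ?_
    simp
  | succ k ih =>
    have h1 : ((k + 1 : ℕ) : ℝ) * ∑ m ∈ sqfreeOmega X (k + 1), (1 : ℝ) / m =
        ∑ m ∈ sqfreeOmega X (k + 1), ∑ p ∈ m.primeFactors,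
          1 / ((m / p : ℕ) : ℝ) * (1 / (p : ℝ)) := by
      rw [Finset.mul_sum]
      refine Finset.sum_congr rfl fun m hm => ?_
      rw [mem_sqfreeOmega] at hm
      rw [← hm.2.2, ← nsmul_eq_mul, ← Finset.sum_const]
      refine Finset.sum_congr rfl fun p hp => ?_
      have hp0 : (p : ℝ) ≠ 0 := by exact_mod_cast (Nat.prime_of_mem_primeFactors hp).ne_zero
      rw [natCast_div_prime hp]
      field_simp
    have h2 := sum_sqfreeOmega_succ_le X k (F := fun m p => 1 / (m : ℝ) * (1 / (p : ℝ)))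
      (fun m p => by positivity)
    have h3 : ∑ m ∈ sqfreeOmega X k, ∑ p ∈ (X / m).primesLE, 1 / (m : ℝ) * (1 / (p : ℝ)) ≤
        (Q ^ k / k.factorial) * Q := by
      refine le_trans (Finset.sum_le_sum fun m _ => ?_)
        ((Finset.sum_mul (sqfreeOmega X k) (fun m : ℕ => 1 / (m : ℝ)) Q).symm.trans_le
          (mul_le_mul_of_nonneg_right ih hQ0))
      rw [← Finset.mul_sum]
      refine mul_le_mul_of_nonneg_left (le_trans ?_ hQ) (by positivity)
      exact Finset.sum_le_sum_of_subset_of_nonneg (Nat.primesLE_mono (Nat.div_le_self X m))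
        fun _ _ _ => by positivity
    have hk : (0 : ℝ) < ((k + 1 : ℕ) : ℝ) := by positivity
    refine le_of_mul_le_mul_left ((h1.trans_le (h2.trans h3)).trans_eq ?_) hk
    rw [Nat.factorial_succ]
    push_cast
    field_simp
    ring

theorem sum_log_div_sqrt_sqfreeOmega_le {X : ℕ} {Q : ℝ}
    (hQ : ∑ p ∈ X.primesLE, (1 : ℝ) / p ≤ Q) (k : ℕ) :
    ∑ m ∈ sqfreeOmega X (k + 1), Real.log m / √m ≤
      2 * Real.log 4 * √X * (Q ^ k / k.factorial) := by
  have hl4 : 0 ≤ Real.log 4 := Real.log_nonneg (by norm_num)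
  have h1 : ∑ m ∈ sqfreeOmega X (k + 1), Real.log m / √m =
      ∑ m ∈ sqfreeOmega X (k + 1), ∑ p ∈ m.primeFactors,
        1 / √((m / p : ℕ) : ℝ) * (Real.log p / √p) := by
    refine Finset.sum_congr rfl fun m hm => ?_
    rw [mem_sqfreeOmega] at hm
    have hlog : Real.log m = ∑ p ∈ m.primeFactors, Real.log p := by
      conv_lhs => rw [← Nat.prod_primeFactors_of_squarefree hm.2.1]
      rw [Nat.cast_prod, Real.log_prod]
      intro p hp
      exact_mod_cast (Nat.prime_of_mem_primeFactors hp).ne_zero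
    rw [hlog, Finset.sum_div]
    refine Finset.sum_congr rfl fun p hp => ?_
    have hp0 : (0 : ℝ) < p := by exact_mod_cast (Nat.prime_of_mem_primeFactors hp).pos
    rw [natCast_div_prime hp, Real.sqrt_div m.cast_nonneg]
    have := Real.sqrt_pos.2 hp0
    field_simp
  have h2 := sum_sqfreeOmega_succ_le X k (F := fun m p => 1 / √(m : ℝ) * (Real.log p / √p))
    (fun m p => mul_nonneg (by positivity)
      (div_nonneg (Real.log_natCast_nonneg p) (Real.sqrt_nonneg _)))
  refine h1.trans_le (h2.trans ?_)
  refine le_trans ?_ (mul_le_mul_of_nonneg_left (sum_one_div_sqfreeOmega_le hQ k)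
    (by positivity : 0 ≤ 2 * Real.log 4 * √(X : ℝ)))
  rw [Finset.mul_sum]
  refine Finset.sum_le_sum fun m hm => ?_
  rw [mem_sqfreeOmega] at hm
  have hm0 : (0 : ℝ) < m := by exact_mod_cast hm.1.1
  rw [← Finset.mul_sum]
  have h3 := sum_log_div_sqrt_prime_le (X / m)
  have h4 : √((X / m : ℕ) : ℝ) ≤ √X / √m := by
    rw [← Real.sqrt_div X.cast_nonneg]
    exact Real.sqrt_le_sqrt Nat.cast_div_le
  have hs := Real.sqrt_pos.2 hm0
  calc 1 / √(m : ℝ) * ∑ p ∈ (X / m).primesLE, Real.log p / √p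
      ≤ 1 / √(m : ℝ) * (2 * Real.log 4 * (√X / √m)) := by gcongr; exact h3.trans (by gcongr)
    _ = 2 * Real.log 4 * √X * (1 / (√m * √m)) := by field_simp
    _ = _ := by rw [Real.mul_self_sqrt hm0.le]

/-- The number of odd prime factors, with multiplicity. -/
def oddOmega (n : ℕ) : ℕ := ArithmeticFunction.cardFactors n - n.factorization 2

theorem factorization_two_le_cardFactors (n : ℕ) :
    n.factorization 2 ≤ ArithmeticFunction.cardFactors n := by
  rw [ArithmeticFunction.cardFactors_eq_sum_factorization, Finsupp.sum]
  by_cases h : 2 ∈ n.factorization.support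
  · exact Finset.single_le_sum (f := fun p => n.factorization p) (fun _ _ => Nat.zero_le _) h
  · rw [Finsupp.notMem_support_iff.1 h]
    exact Nat.zero_le _

theorem oddOmega_mul {a b : ℕ} (ha : a ≠ 0) (hb : b ≠ 0) :
    oddOmega (a * b) = oddOmega a + oddOmega b := by
  have h1 := factorization_two_le_cardFactors a
  have h2 := factorization_two_le_cardFactors b
  have h3 : (a * b).factorization 2 = a.factorization 2 + b.factorization 2 := by
    rw [Nat.factorization_mul ha hb, Finsupp.add_apply]
  rw [oddOmega, oddOmega, oddOmega, ArithmeticFunction.cardFactors_mul ha hb, h3]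
  omega

theorem card_primeFactors_eq_cardFactors {m : ℕ} (hm : Squarefree m) :
    m.primeFactors.card = ArithmeticFunction.cardFactors m := by
  rw [← (ArithmeticFunction.cardDistinctFactors_eq_cardFactors_iff_squarefree hm.ne_zero).2 hm]
  rfl

theorem oddOmega_le_card_primeFactors {m : ℕ} (hm : Squarefree m) :
    oddOmega m ≤ m.primeFactors.card := by
  rw [card_primeFactors_eq_cardFactors hm]
  exact Nat.sub_le _ _

theorem card_primeFactors_le_oddOmega_add_one {m : ℕ} (hm : Squarefree m) :
    m.primeFactors.card ≤ oddOmega m + 1 := by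
  have h := hm.natFactorization_le_one 2
  rw [card_primeFactors_eq_cardFactors hm, oddOmega]
  omega

theorem three_pow_oddOmega_le {n : ℕ} (hn : n ≠ 0) : 3 ^ oddOmega n ≤ n := by
  induction n using Nat.recOnMul with
  | zero => exact absurd rfl hn
  | one => simp [oddOmega]
  | prime p hp =>
    rw [oddOmega, ArithmeticFunction.cardFactors_apply_prime hp, hp.factorization]
    rcases hp.eq_two_or_odd' with rfl | h
    · simp
    · have h2 : p ≠ 2 := by rintro rfl; revert h; decide
      have := hp.two_le
      rw [Finsupp.single_eq_of_ne' h2]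
      simp; omega
  | mul a b iha ihb =>
    have ha : a ≠ 0 := left_ne_zero_of_mul hn
    have hb : b ≠ 0 := right_ne_zero_of_mul hn
    rw [oddOmega_mul ha hb, pow_add]
    exact Nat.mul_le_mul (iha ha) (ihb hb)

/-- The pairs `(d, m)` with `m` squarefree and `d ^ 2 * m ≤ X`. -/
def sqPairs (X : ℕ) : Finset (ℕ × ℕ) :=
  (Finset.Icc 1 X ×ˢ Finset.Icc 1 X).filter fun x => Squarefree x.2 ∧ x.1 ^ 2 * x.2 ≤ X

theorem mem_sqPairs {X : ℕ} {x : ℕ × ℕ} :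
    x ∈ sqPairs X ↔ (1 ≤ x.1 ∧ 1 ≤ x.2) ∧ Squarefree x.2 ∧ x.1 ^ 2 * x.2 ≤ X := by
  simp only [sqPairs, Finset.mem_filter, Finset.mem_product, Finset.mem_Icc]
  constructor
  · rintro ⟨⟨⟨h1, -⟩, h2, -⟩, h3⟩
    exact ⟨⟨h1, h2⟩, h3⟩
  · rintro ⟨⟨h1, h2⟩, h3, h4⟩
    have h5 : x.1 ≤ x.1 ^ 2 * x.2 := by nlinarith [Nat.mul_le_mul h1 h2]
    have h6 : x.2 ≤ x.1 ^ 2 * x.2 := Nat.le_mul_of_pos_left _ (by positivity)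
    exact ⟨⟨⟨h1, h5.trans h4⟩, h2, h6.trans h4⟩, h3, h4⟩

theorem sum_Icc_le_sum_sqPairs (X : ℕ) {g : ℕ → ℝ} (hg : ∀ n, 0 ≤ g n) :
    ∑ n ∈ Finset.Icc 1 X, g n ≤ ∑ x ∈ sqPairs X, g (x.1 ^ 2 * x.2) := by
  choose a b hab hsq using Nat.sq_mul_squarefree
  refine sum_le_sum_of_injOn (fun n => (b n, a n)) ?_ ?_ ?_ fun _ _ => hg _
  · intro n hn
    rw [Finset.mem_Icc] at hn
    rw [mem_sqPairs]
    have h := hab n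
    refine ⟨⟨Nat.pos_of_ne_zero fun h0 => ?_, Nat.pos_of_ne_zero fun h0 => ?_⟩, hsq n, ?_⟩
    · simp only at h0
      rw [h0] at h
      simp at h; omega
    · simp only at h0
      rw [h0] at h
      simp at h; omega
    · simp only
      omega
  · intro n _ n' _ h
    simp only [Prod.mk.injEq] at h
    rw [← hab n, ← hab n', h.1, h.2]
  · intro n _
    simp only [hab]
    exact le_rfl

/-- The weight `1 / √(d ^ 2 * m)`. -/
noncomputable def sqWeight (x : ℕ × ℕ) : ℝ := 1 / (x.1 * √(x.2 : ℝ))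

theorem sqWeight_nonneg (x : ℕ × ℕ) : 0 ≤ sqWeight x := by
  unfold sqWeight
  positivity

theorem one_div_sqrt_sq_mul (d m : ℕ) : 1 / √((d ^ 2 * m : ℕ) : ℝ) = sqWeight (d, m) := by
  rw [sqWeight]
  push_cast
  rw [Real.sqrt_mul (by positivity), Real.sqrt_sq d.cast_nonneg]

theorem sum_sqPairs_le (X : ℕ) {F : ℕ × ℕ → ℝ} (hF : ∀ x, 0 ≤ F x) (p : ℕ → Prop)
    [DecidablePred p] :
    ∑ x ∈ (sqPairs X).filter (fun x => p x.2), F x ≤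
      ∑ d ∈ Finset.Icc 1 X, ∑ m ∈ (Finset.Icc 1 (X / d ^ 2)).filter
        (fun m => Squarefree m ∧ p m), F (d, m) := by
  rw [Finset.sum_sigma']
  refine sum_le_sum_of_injOn (fun x => ⟨x.1, x.2⟩) ?_ ?_ (fun x _ => le_rfl) fun _ _ => hF _
  · intro x hx
    rw [Finset.mem_filter] at hx
    have h0 := (Finset.mem_product.1 (Finset.mem_filter.1 hx.1).1).1
    rw [mem_sqPairs] at hx
    rw [Finset.mem_sigma, Finset.mem_filter]
    obtain ⟨⟨⟨h1, h2⟩, h3, h4⟩, h5⟩ := hx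
    dsimp only
    rw [Finset.mem_Icc (a := 1) (b := X / x.1 ^ 2)]
    refine ⟨h0, ⟨h2, ?_⟩, h3, h5⟩
    rw [Nat.le_div_iff_mul_le (by positivity), mul_comm]
    exact h4
  · rintro ⟨a, b⟩ _ ⟨a', b'⟩ _ h
    simp only [Sigma.mk.injEq, heq_eq_eq] at h
    rw [h.1, h.2]

theorem sum_one_div_sqrt_le (n : ℕ) : ∑ m ∈ Finset.Icc 1 n, 1 / √(m : ℝ) ≤ 2 * √n := by
  induction n with
  | zero => simp
  | succ n ih =>
    rw [Finset.sum_Icc_succ_top (by omega)]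
    have hb : 0 < √((n + 1 : ℕ) : ℝ) := Real.sqrt_pos.2 (by positivity)
    have hbb : √((n + 1 : ℕ) : ℝ) * √((n + 1 : ℕ) : ℝ) = n + 1 := by
      rw [Real.mul_self_sqrt (by positivity)]
      push_cast
      rfl
    have haa : √(n : ℝ) * √(n : ℝ) = n := Real.mul_self_sqrt n.cast_nonneg
    set a := √(n : ℝ)
    set b := √((n + 1 : ℕ) : ℝ)
    have h1 : 1 / b ≤ 2 * (b - a) := by
      rw [div_le_iff₀ hb]
      nlinarith [sq_nonneg (b - a)]
    linarith

theorem sum_one_div_sq_le (n : ℕ) : ∑ d ∈ Finset.Icc 1 n, 1 / (d : ℝ) ^ 2 ≤ 2 := by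
  have key : ∀ n : ℕ, ∑ d ∈ Finset.Icc 1 (n + 1), 1 / (d : ℝ) ^ 2 ≤ 2 - 1 / ((n : ℝ) + 1) := by
    intro n
    induction n with
    | zero => norm_num
    | succ n ih =>
      rw [Finset.sum_Icc_succ_top (by omega)]
      have h1 : 1 / ((n : ℝ) + 1 + 1) ^ 2 ≤ 1 / ((n : ℝ) + 1) - 1 / ((n : ℝ) + 1 + 1) := by
        rw [div_sub_div _ _ (by positivity) (by positivity), div_le_div_iff₀ (by positivity)
          (by positivity)]
        have : (0 : ℝ) ≤ n := n.cast_nonneg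
        nlinarith
      push_cast at ih ⊢
      linarith
  rcases n with _ | n
  · simp
  · have : (0 : ℝ) ≤ 1 / ((n : ℝ) + 1) := by positivity
    linarith [key n]

theorem sum_one_div_le (n : ℕ) : ∑ d ∈ Finset.Icc 1 n, 1 / (d : ℝ) ≤ 1 + Real.log n := by
  have h := harmonic_le_one_add_log n
  rw [harmonic_eq_sum_Icc] at h
  push_cast at h
  simpa [one_div] using h

theorem sqrt_div_sq_le (X d : ℕ) : √((X / d ^ 2 : ℕ) : ℝ) ≤ √X / d := by
  calc √((X / d ^ 2 : ℕ) : ℝ) ≤ √((X : ℝ) / ((d ^ 2 : ℕ) : ℝ)) :=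
        Real.sqrt_le_sqrt Nat.cast_div_le
    _ = √X / d := by
        push_cast
        rw [Real.sqrt_div X.cast_nonneg, Real.sqrt_sq d.cast_nonneg]

theorem sum_sqWeight_le (X : ℕ) : ∑ x ∈ sqPairs X, sqWeight x ≤ 4 * √X := by
  have h := sum_sqPairs_le X sqWeight_nonneg (fun _ => True)
  rw [Finset.filter_true] at h
  refine h.trans ?_
  have h1 : ∀ d ∈ Finset.Icc 1 X, ∑ m ∈ (Finset.Icc 1 (X / d ^ 2)).filter
      (fun m => Squarefree m ∧ True), sqWeight (d, m) ≤ 2 * √X * (1 / (d : ℝ) ^ 2) := by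
    intro d _
    calc _ ≤ ∑ m ∈ Finset.Icc 1 (X / d ^ 2), sqWeight (d, m) :=
          Finset.sum_le_sum_of_subset_of_nonneg (Finset.filter_subset _ _)
            fun _ _ _ => sqWeight_nonneg _
      _ = 1 / (d : ℝ) * ∑ m ∈ Finset.Icc 1 (X / d ^ 2), 1 / √(m : ℝ) := by
          rw [Finset.mul_sum]
          exact Finset.sum_congr rfl fun m _ => by rw [sqWeight, one_div_mul_one_div]
      _ ≤ 1 / (d : ℝ) * (2 * (√X / d)) := by
          gcongr
          exact (sum_one_div_sqrt_le _).trans (by gcongr; exact sqrt_div_sq_le X d)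
      _ = _ := by ring
  refine (Finset.sum_le_sum h1).trans ?_
  rw [← Finset.mul_sum]
  nlinarith [sum_one_div_sq_le X, Real.sqrt_nonneg (X : ℝ)]

theorem sum_sqWeight_small_le (X : ℕ) :
    ∑ x ∈ (sqPairs X).filter (fun x => x.2 ^ 8 < X), sqWeight x ≤
      (X : ℝ) ^ (1 / 8 : ℝ) * (1 + Real.log X) := by
  refine (sum_sqPairs_le X sqWeight_nonneg (fun m => m ^ 8 < X)).trans ?_
  have h1 : ∀ d ∈ Finset.Icc 1 X, ∑ m ∈ (Finset.Icc 1 (X / d ^ 2)).filter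
      (fun m => Squarefree m ∧ m ^ 8 < X), sqWeight (d, m) ≤
        (X : ℝ) ^ (1 / 8 : ℝ) * (1 / (d : ℝ)) := by
    intro d _
    have hsub : (Finset.Icc 1 (X / d ^ 2)).filter (fun m => Squarefree m ∧ m ^ 8 < X) ⊆
        Finset.Icc 1 ⌊(X : ℝ) ^ (1 / 8 : ℝ)⌋₊ := by
      intro m hm
      rw [Finset.mem_filter, Finset.mem_Icc] at hm
      rw [Finset.mem_Icc]
      refine ⟨hm.1.1, Nat.le_floor ?_⟩
      have h8 : ((m : ℝ) ^ (8 : ℕ)) ≤ X := by exact_mod_cast hm.2.2.le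
      calc (m : ℝ) = ((m : ℝ) ^ (8 : ℕ)) ^ (1 / 8 : ℝ) := by
            rw [← Real.rpow_natCast, ← Real.rpow_mul m.cast_nonneg]
            norm_num
        _ ≤ _ := Real.rpow_le_rpow (by positivity) h8 (by norm_num)
    calc _ ≤ ∑ m ∈ (Finset.Icc 1 (X / d ^ 2)).filter
            (fun m => Squarefree m ∧ m ^ 8 < X), 1 / (d : ℝ) := by
          refine Finset.sum_le_sum fun m hm => ?_
          rw [Finset.mem_filter, Finset.mem_Icc] at hm
          have : (1 : ℝ) ≤ √(m : ℝ) := Real.one_le_sqrt.2 (by exact_mod_cast hm.1.1)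
          rw [sqWeight, ← one_div_mul_one_div]
          refine mul_le_of_le_one_right (by positivity) ?_
          rw [div_le_one (by linarith)]
          exact this
      _ = _ := by rw [Finset.sum_const, nsmul_eq_mul]
      _ ≤ (X : ℝ) ^ (1 / 8 : ℝ) * (1 / (d : ℝ)) := by
          gcongr
          have := Finset.card_le_card hsub
          rw [Nat.card_Icc, Nat.add_sub_cancel] at this
          exact (Nat.cast_le.2 this).trans (Nat.floor_le (by positivity))
  refine (Finset.sum_le_sum h1).trans ?_
  rw [← Finset.mul_sum]
  exact mul_le_mul_of_nonneg_left (sum_one_div_le X) (by positivity)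

theorem sum_sqWeight_card_eq_le {X : ℕ} (hX : 2 ≤ X) {Q : ℝ}
    (hQ : ∑ p ∈ X.primesLE, (1 : ℝ) / p ≤ Q) (k : ℕ) {h : ℕ → ℝ} (hh : ∀ d, 0 ≤ h d) :
    ∑ x ∈ (sqPairs X).filter (fun x => X ≤ x.2 ^ 8 ∧ x.2.primeFactors.card = k + 1),
      h x.1 * sqWeight x ≤
      16 * Real.log 4 * √X / Real.log X * (Q ^ k / k.factorial) *
        ∑ d ∈ Finset.Icc 1 X, h d / (d : ℝ) ^ 2 := by
  have hX1 : (1 : ℝ) < X := by exact_mod_cast hX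
  have hlX : 0 < Real.log X := Real.log_pos hX1
  have hl4 : 0 ≤ Real.log 4 := Real.log_nonneg (by norm_num)
  have hQ0 : 0 ≤ Q := le_trans (Finset.sum_nonneg fun p _ => by positivity) hQ
  refine (sum_sqPairs_le X (fun x => mul_nonneg (hh x.1) (sqWeight_nonneg x))
    (fun m => X ≤ m ^ 8 ∧ m.primeFactors.card = k + 1)).trans ?_
  rw [Finset.mul_sum]
  refine Finset.sum_le_sum fun d hd => ?_
  have hsub : (Finset.Icc 1 (X / d ^ 2)).filter
      (fun m => Squarefree m ∧ X ≤ m ^ 8 ∧ m.primeFactors.card = k + 1) ⊆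
        sqfreeOmega (X / d ^ 2) (k + 1) := by
    intro m hm
    rw [Finset.mem_filter, Finset.mem_Icc] at hm
    rw [mem_sqfreeOmega]
    exact ⟨hm.1, hm.2.1, hm.2.2.2⟩
  have hQd : ∑ p ∈ (X / d ^ 2).primesLE, (1 : ℝ) / p ≤ Q :=
    (Finset.sum_le_sum_of_subset_of_nonneg (Nat.primesLE_mono (Nat.div_le_self X _))
      fun _ _ _ => by positivity).trans hQ
  calc _ ≤ ∑ m ∈ (Finset.Icc 1 (X / d ^ 2)).filter
        (fun m => Squarefree m ∧ X ≤ m ^ 8 ∧ m.primeFactors.card = k + 1),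
          h d / d * (8 / Real.log X) * (Real.log m / √m) := by
        refine Finset.sum_le_sum fun m hm => ?_
        rw [Finset.mem_filter, Finset.mem_Icc] at hm
        have hlog : Real.log X ≤ 8 * Real.log m := by
          have : (X : ℝ) ≤ (m : ℝ) ^ 8 := by exact_mod_cast hm.2.2.1
          calc Real.log X ≤ Real.log ((m : ℝ) ^ 8) := Real.log_le_log (by linarith) this
            _ = _ := by rw [Real.log_pow]; norm_num
        have h1 : 1 ≤ 8 / Real.log X * Real.log m := by
          rw [div_mul_eq_mul_div, one_le_div hlX]
          exact hlog
        have h2 : h d * sqWeight (d, m) = h d / d * (1 / √(m : ℝ)) * 1 := by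
          rw [sqWeight, ← one_div_mul_one_div]
          ring
        have h3 : h d / d * (8 / Real.log X) * (Real.log m / √(m : ℝ)) =
            h d / d * (1 / √(m : ℝ)) * (8 / Real.log X * Real.log m) := by ring
        rw [h2, h3]
        exact mul_le_mul_of_nonneg_left h1
          (mul_nonneg (div_nonneg (hh d) d.cast_nonneg) (by positivity))
    _ = h d / d * (8 / Real.log X) * ∑ m ∈ (Finset.Icc 1 (X / d ^ 2)).filter
        (fun m => Squarefree m ∧ X ≤ m ^ 8 ∧ m.primeFactors.card = k + 1),
          Real.log m / √m := by rw [Finset.mul_sum]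
    _ ≤ h d / d * (8 / Real.log X) *
          (2 * Real.log 4 * (√X / d) * (Q ^ k / k.factorial)) := by
        refine mul_le_mul_of_nonneg_left ?_
          (mul_nonneg (div_nonneg (hh d) d.cast_nonneg) (by positivity))
        refine (Finset.sum_le_sum_of_subset_of_nonneg hsub fun m _ _ =>
          div_nonneg (Real.log_natCast_nonneg m) (Real.sqrt_nonneg _)).trans ?_
        refine (sum_log_div_sqrt_sqfreeOmega_le hQd k).trans ?_
        gcongr
        exact sqrt_div_sq_le X d
    _ = _ := by ring

theorem pow_div_factorial_le_self (K i : ℕ) :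
    (K : ℝ) ^ i / i.factorial ≤ (K : ℝ) ^ K / K.factorial := by
  rw [div_le_div_iff₀ (by positivity) (by positivity)]
  norm_cast
  rcases le_total K i with h | h
  · calc K ^ i * K.factorial = K ^ K * (K.factorial * K ^ (i - K)) := by
          rw [← Nat.add_sub_of_le h, pow_add, Nat.add_sub_cancel_left]
          ring
      _ ≤ _ := Nat.mul_le_mul_left _ (Nat.factorial_mul_pow_sub_le_factorial h)
  · have h1 := Nat.factorial_mul_descFactorial (Nat.sub_le K i)
    rw [Nat.sub_sub_self h] at h1
    calc K ^ i * K.factorial = K ^ i * (i.factorial * K.descFactorial (K - i)) := by rw [h1]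
      _ ≤ K ^ i * (i.factorial * K ^ (K - i)) := by gcongr; exact Nat.descFactorial_le_pow _ _
      _ = K ^ (i + (K - i)) * i.factorial := by rw [pow_add]; ring
      _ = _ := by rw [Nat.add_sub_of_le h]

theorem mul_pow_div_factorial_le (K i : ℕ) {c : ℝ} (hc : 0 ≤ c) :
    ((K : ℝ) * c) ^ i / i.factorial ≤ (K : ℝ) ^ K / K.factorial * c ^ i := by
  rw [mul_pow, mul_div_right_comm]
  exact mul_le_mul_of_nonneg_right (pow_div_factorial_le_self K i) (by positivity)

theorem sum_antidiagonal_pow_div_factorial (Q : ℝ) (s : ℕ) :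
    ∑ x ∈ Finset.HasAntidiagonal.antidiagonal s,
        Q ^ x.1 / x.1.factorial * (Q ^ x.2 / x.2.factorial) =
      (2 * Q) ^ s / s.factorial := by
  rw [two_mul, (Commute.all Q Q).add_pow', Finset.sum_div]
  refine Finset.sum_congr rfl fun x hx => ?_
  rw [Finset.HasAntidiagonal.mem_antidiagonal] at hx
  subst hx
  have h := Nat.add_choose_mul_factorial_mul_factorial x.1 x.2
  have h' : ((x.1 + x.2).choose x.1 : ℝ) * x.1.factorial * x.2.factorial =
      (x.1 + x.2).factorial := by
    rw [Nat.choose_symm_add]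
    exact_mod_cast h
  rw [nsmul_eq_mul, ← h']
  have h0 : ((x.1 + x.2).choose x.1 : ℝ) ≠ 0 := by
    exact_mod_cast (Nat.choose_pos (Nat.le_add_right _ _)).ne'
  field_simp

theorem sum_sqPairs_large_eq {X : ℕ} (hX : 2 ≤ X) (F : ℕ × ℕ → ℝ) :
    ∑ x ∈ (sqPairs X).filter (fun x => X ≤ x.2 ^ 8), F x =
      ∑ k ∈ Finset.range X, ∑ x ∈ (sqPairs X).filter
        (fun x => X ≤ x.2 ^ 8 ∧ x.2.primeFactors.card = k + 1), F x := by
  have hmaps : ∀ x ∈ (sqPairs X).filter (fun x => X ≤ x.2 ^ 8),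
      x.2.primeFactors.card ∈ Finset.range (X + 1) := by
    intro x hx
    rw [Finset.mem_filter, mem_sqPairs] at hx
    have h1 : x.2 ≤ X :=
      (Nat.le_mul_of_pos_left x.2 (by have := hx.1.1.1; positivity)).trans hx.1.2.2
    have h2 : x.2.primeFactors ⊆ Finset.Icc 1 x.2 := by
      intro p hp
      rw [Finset.mem_Icc]
      exact ⟨(Nat.prime_of_mem_primeFactors hp).one_lt.le, Nat.le_of_mem_primeFactors hp⟩
    have h3 := Finset.card_le_card h2
    rw [Nat.card_Icc] at h3
    rw [Finset.mem_range]
    omega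
  rw [← Finset.sum_fiberwise_of_maps_to hmaps, Finset.sum_range_succ']
  simp only [Finset.filter_filter]
  have hempty : (sqPairs X).filter
      (fun x => X ≤ x.2 ^ 8 ∧ x.2.primeFactors.card = 0) = ∅ := by
    rw [Finset.filter_eq_empty_iff]
    rintro x hx ⟨h1, h2⟩
    rw [mem_sqPairs] at hx
    rw [Finset.card_eq_zero, Nat.primeFactors_eq_empty] at h2
    have h3 : x.2 = 1 := by omega
    rw [h3] at h1
    omega
  rw [hempty, Finset.sum_empty, add_zero]

theorem oddOmega_sq_mul {d m : ℕ} (hd : 1 ≤ d) (hm : 1 ≤ m) :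
    oddOmega (d ^ 2 * m) = 2 * oddOmega d + oddOmega m := by
  rw [oddOmega_mul (by positivity) (by omega), sq, oddOmega_mul (by omega) (by omega)]
  ring

theorem log_two_pos : 0 < Real.log 2 := Real.log_pos (by norm_num)

theorem log_two_lt_one : Real.log 2 < 1 := by
  have := Real.log_two_lt_d9
  linarith

theorem inv_log_two_pow_le {d : ℕ} (hd : 1 ≤ d) :
    ((1 / Real.log 2) ^ 2) ^ oddOmega d ≤ (d : ℝ) ^ (3 / 4 : ℝ) := by
  have h0 := log_two_pos
  have h1 : (1 / Real.log 2) ^ 2 ≤ (3 : ℝ) ^ (3 / 4 : ℝ) := by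
    have h2 : (1 / Real.log 2) ^ 2 ≤ 2.1 := by
      have := Real.log_two_gt_d9
      rw [div_pow, one_pow, div_le_iff₀ (by positivity)]
      nlinarith
    refine h2.trans ?_
    have h3 : (2.1 : ℝ) = (2.1 ^ (4 : ℕ)) ^ (1 / 4 : ℝ) := by
      rw [← Real.rpow_natCast, ← Real.rpow_mul (by norm_num)]
      norm_num
    have h4 : (3 : ℝ) ^ (3 / 4 : ℝ) = (3 ^ (3 : ℕ)) ^ (1 / 4 : ℝ) := by
      rw [← Real.rpow_natCast, ← Real.rpow_mul (by norm_num)]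
      norm_num
    rw [h3, h4]
    exact Real.rpow_le_rpow (by norm_num) (by norm_num) (by norm_num)
  calc ((1 / Real.log 2) ^ 2) ^ oddOmega d ≤ ((3 : ℝ) ^ (3 / 4 : ℝ)) ^ oddOmega d := by gcongr
    _ = ((3 : ℝ) ^ oddOmega d) ^ (3 / 4 : ℝ) := by
        rw [← Real.rpow_natCast, ← Real.rpow_natCast, ← Real.rpow_mul (by norm_num),
          ← Real.rpow_mul (by norm_num), mul_comm]
    _ ≤ _ := by
        refine Real.rpow_le_rpow (by positivity) ?_ (by norm_num)
        exact_mod_cast three_pow_oddOmega_le (by omega)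

theorem exists_sum_inv_log_two_pow_le :
    ∃ B : ℝ, 0 ≤ B ∧ ∀ X : ℕ,
      ∑ d ∈ Finset.Icc 1 X, ((1 / Real.log 2) ^ 2) ^ oddOmega d / (d : ℝ) ^ 2 ≤ B := by
  have hs : Summable fun d : ℕ => 1 / (d : ℝ) ^ (5 / 4 : ℝ) :=
    Real.summable_one_div_nat_rpow.2 (by norm_num)
  refine ⟨∑' d : ℕ, 1 / (d : ℝ) ^ (5 / 4 : ℝ), tsum_nonneg fun d => by positivity, fun X => ?_⟩
  refine le_trans (Finset.sum_le_sum fun d hd => ?_)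
    (hs.sum_le_tsum (Finset.Icc 1 X) fun d _ => by positivity)
  rw [Finset.mem_Icc] at hd
  have hd0 : (0 : ℝ) < d := by exact_mod_cast hd.1
  calc _ ≤ (d : ℝ) ^ (3 / 4 : ℝ) / (d : ℝ) ^ 2 := by gcongr; exact inv_log_two_pow_le hd.1
    _ = _ := by
        rw [← Real.rpow_natCast, ← Real.rpow_sub hd0, one_div, ← Real.rpow_neg hd0.le]
        norm_num

theorem sum_filter_log_two_pow_le (n K f : ℕ) :
    ∑ k ∈ Finset.range n, (if K ≤ 2 * f + (k + 1) then Real.log 2 ^ k else 0) ≤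
      Real.log 2 ^ K / (Real.log 2 * (1 - Real.log 2)) * ((1 / Real.log 2) ^ 2) ^ f := by
  have h0 := log_two_pos
  have h1 := log_two_lt_one
  set J := K - (2 * f + 1) with hJ
  rw [← Finset.sum_filter]
  have hsub : (Finset.range n).filter (fun k => K ≤ 2 * f + (k + 1)) ⊆ Finset.Ico J n := by
    intro k hk
    rw [Finset.mem_filter, Finset.mem_range] at hk
    rw [Finset.mem_Ico]
    omega
  refine (Finset.sum_le_sum_of_subset_of_nonneg hsub fun _ _ _ => by positivity).trans ?_
  refine (geom_sum_Ico_le_of_lt_one h0.le h1).trans ?_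
  have h2 : Real.log 2 ^ J * Real.log 2 ^ (2 * f + 1) ≤ Real.log 2 ^ K := by
    rw [← pow_add]
    exact pow_le_pow_of_le_one h0.le h1.le (by omega)
  have h3 : 0 < 1 - Real.log 2 := by linarith
  have h4 : Real.log 2 ^ K / (Real.log 2 * (1 - Real.log 2)) * ((1 / Real.log 2) ^ 2) ^ f =
      Real.log 2 ^ K / Real.log 2 ^ (2 * f + 1) / (1 - Real.log 2) := by
    rw [← pow_mul, div_pow, one_pow, pow_succ]
    field_simp
  rw [h4]
  gcongr
  rwa [le_div_iff₀ (by positivity)]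

/-- Integers with many prime factors. -/
theorem exists_sum_many_prime_factors_le :
    ∃ C : ℝ, 0 ≤ C ∧ ∀ X K : ℕ, 2 ≤ X →
      ∑ p ∈ X.primesLE, (1 : ℝ) / p ≤ K * Real.log 2 →
      ∑ n ∈ (Finset.Icc 1 X).filter (fun n => K ≤ oddOmega n), 1 / √(n : ℝ) ≤
        (X : ℝ) ^ (1 / 8 : ℝ) * (1 + Real.log X) +
          C * √X / Real.log X * ((K : ℝ) ^ K / K.factorial * Real.log 2 ^ K) := by
  obtain ⟨B, hB0, hB⟩ := exists_sum_inv_log_two_pow_le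
  have h0 := log_two_pos
  have h1 : 0 < 1 - Real.log 2 := by linarith [log_two_lt_one]
  have hl4 : 0 ≤ Real.log 4 := Real.log_nonneg (by norm_num)
  refine ⟨16 * Real.log 4 * B / (Real.log 2 * (1 - Real.log 2)), by positivity, ?_⟩
  intro X K hX hQ
  have hlX : 0 < Real.log X := Real.log_pos (by exact_mod_cast hX)
  set M : ℝ := (K : ℝ) ^ K / K.factorial
  have hM : 0 ≤ M := by positivity
  set A : ℝ := 16 * Real.log 4 * √X / Real.log X with hA
  have hA0 : 0 ≤ A := by positivity
  rw [Finset.sum_filter]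
  refine (sum_Icc_le_sum_sqPairs X (g := fun n => if K ≤ oddOmega n then 1 / √(n : ℝ) else 0)
    fun n => by split_ifs <;> positivity).trans ?_
  set F : ℕ × ℕ → ℝ := fun x =>
    if K ≤ 2 * oddOmega x.1 + x.2.primeFactors.card then sqWeight x else 0
  have hF : ∀ x ∈ sqPairs X, (if K ≤ oddOmega (x.1 ^ 2 * x.2) then
      1 / √((x.1 ^ 2 * x.2 : ℕ) : ℝ) else 0) ≤ F x := by
    intro x hx
    rw [mem_sqPairs] at hx
    have h2 := oddOmega_le_card_primeFactors hx.2.1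
    rw [oddOmega_sq_mul hx.1.1 hx.1.2, one_div_sqrt_sq_mul]
    simp only [F]
    split_ifs
    · exact le_rfl
    · omega
    · exact sqWeight_nonneg _
    · exact le_rfl
  refine (Finset.sum_le_sum hF).trans ?_
  rw [← Finset.sum_filter_add_sum_filter_not (sqPairs X) (fun x => x.2 ^ 8 < X)]
  refine add_le_add ((Finset.sum_le_sum fun x _ => ?_).trans (sum_sqWeight_small_le X)) ?_
  · simp only [F]
    split_ifs
    · exact le_rfl
    · exact sqWeight_nonneg _
  simp only [not_lt]
  rw [sum_sqPairs_large_eq hX]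
  have h3 : ∀ k ∈ Finset.range X, ∑ x ∈ (sqPairs X).filter
      (fun x => X ≤ x.2 ^ 8 ∧ x.2.primeFactors.card = k + 1), F x ≤
        A * M * ∑ d ∈ Finset.Icc 1 X,
          (if K ≤ 2 * oddOmega d + (k + 1) then Real.log 2 ^ k else 0) / (d : ℝ) ^ 2 := by
    intro k _
    have h4 := sum_sqWeight_card_eq_le hX hQ k
      (h := fun d => if K ≤ 2 * oddOmega d + (k + 1) then 1 else 0)
      fun d => by split_ifs <;> norm_num
    calc _ = _ := Finset.sum_congr rfl fun x hx => ?_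
      _ ≤ _ := h4
      _ ≤ A * (M * Real.log 2 ^ k) * ∑ d ∈ Finset.Icc 1 X,
          (if K ≤ 2 * oddOmega d + (k + 1) then 1 else 0) / (d : ℝ) ^ 2 := by
        have : (0 : ℝ) ≤ ∑ d ∈ Finset.Icc 1 X,
            (if K ≤ 2 * oddOmega d + (k + 1) then 1 else 0) / (d : ℝ) ^ 2 :=
          Finset.sum_nonneg fun d _ => by split_ifs <;> positivity
        gcongr
        exact mul_pow_div_factorial_le K k h0.le
      _ = _ := ?_
    · rw [Finset.mem_filter] at hx
      simp only [F, hx.2.2]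
      split_ifs <;> simp
    · rw [← mul_assoc, mul_assoc, Finset.mul_sum]
      congr 1
      refine Finset.sum_congr rfl fun d _ => ?_
      split_ifs <;> ring
  refine (Finset.sum_le_sum h3).trans ?_
  rw [← Finset.mul_sum, Finset.sum_comm]
  have h5 : ∀ d ∈ Finset.Icc 1 X, ∑ k ∈ Finset.range X,
      (if K ≤ 2 * oddOmega d + (k + 1) then Real.log 2 ^ k else 0) / (d : ℝ) ^ 2 ≤
        Real.log 2 ^ K / (Real.log 2 * (1 - Real.log 2)) *
          (((1 / Real.log 2) ^ 2) ^ oddOmega d / (d : ℝ) ^ 2) := by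
    intro d _
    rw [← Finset.sum_div, ← mul_div_assoc]
    gcongr
    exact sum_filter_log_two_pow_le X K (oddOmega d)
  calc _ ≤ A * M * (Real.log 2 ^ K / (Real.log 2 * (1 - Real.log 2)) * B) := by
        gcongr
        refine (Finset.sum_le_sum h5).trans ?_
        rw [← Finset.mul_sum]
        gcongr
        exact hB X
    _ = _ := by rw [hA]; ring

theorem sum_add_lt_pow_div_factorial_le (n K : ℕ) {Q : ℝ} (hQ : 0 ≤ Q) :
    ∑ k ∈ Finset.range n, ∑ l ∈ Finset.range n,
      (if k + l < K then Q ^ k / k.factorial * (Q ^ l / l.factorial) else 0) ≤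
      ∑ s ∈ Finset.range K, (2 * Q) ^ s / s.factorial := by
  rw [← Finset.sum_product', ← Finset.sum_filter]
  simp only [← sum_antidiagonal_pow_div_factorial]
  rw [Finset.sum_sigma']
  refine sum_le_sum_of_injOn (fun x => ⟨x.1 + x.2, x⟩) ?_ ?_ (fun x _ => le_rfl)
    fun _ _ => by positivity
  · intro x hx
    rw [Finset.mem_filter] at hx
    simpa using hx.2
  · rintro x _ y _ h
    simp only [Sigma.mk.injEq, heq_eq_eq] at h
    exact h.2

/-- Pairs of integers with few prime factors in total. -/
theorem exists_sum_few_prime_factors_le :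
    ∃ C : ℝ, 0 ≤ C ∧ ∀ X K : ℕ, 2 ≤ X →
      ∑ p ∈ X.primesLE, (1 : ℝ) / p ≤ K * Real.log 2 →
      ∑ a ∈ Finset.Icc 1 X, ∑ b ∈ Finset.Icc 1 X,
        (if oddOmega a + oddOmega b < K then 1 / √(a : ℝ) * (1 / √(b : ℝ)) else 0) ≤
        8 * √X * ((X : ℝ) ^ (1 / 8 : ℝ) * (1 + Real.log X)) +
          C * X / Real.log X ^ 2 * ((K : ℝ) ^ K / K.factorial * (2 * Real.log 2) ^ K) := by
  have h0 := log_two_pos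
  have h1 : 0 < 2 * Real.log 2 - 1 := by linarith [Real.log_two_gt_d9]
  have hl4 : 0 ≤ Real.log 4 := Real.log_nonneg (by norm_num)
  refine ⟨(32 * Real.log 4) ^ 2 / (2 * Real.log 2 - 1), by positivity, ?_⟩
  intro X K hX hQ
  have hlX : 0 < Real.log X := Real.log_pos (by exact_mod_cast hX)
  set Q : ℝ := K * Real.log 2
  have hQ0 : 0 ≤ Q := by positivity
  set M : ℝ := (K : ℝ) ^ K / K.factorial
  have hM : 0 ≤ M := by positivity
  set G : ℕ × ℕ → ℕ × ℕ → ℝ := fun x y =>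
    if x.2.primeFactors.card + y.2.primeFactors.card < K + 2 then sqWeight x * sqWeight y else 0
    with hG
  have hww : ∀ x y, 0 ≤ sqWeight x * sqWeight y := fun x y =>
    mul_nonneg (sqWeight_nonneg x) (sqWeight_nonneg y)
  have hGle : ∀ x y, G x y ≤ sqWeight x * sqWeight y := by
    intro x y
    simp only [G]
    split_ifs
    · exact le_rfl
    · exact hww x y
  have hG0 : ∀ x y, 0 ≤ G x y := by
    intro x y
    simp only [G]
    split_ifs
    · exact hww x y
    · exact le_rfl
  have step1 : ∑ a ∈ Finset.Icc 1 X, ∑ b ∈ Finset.Icc 1 X,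
      (if oddOmega a + oddOmega b < K then 1 / √(a : ℝ) * (1 / √(b : ℝ)) else 0) ≤
        ∑ x ∈ sqPairs X, ∑ y ∈ sqPairs X, G x y := by
    have hnn : ∀ a b : ℕ, 0 ≤
        (if oddOmega a + oddOmega b < K then 1 / √(a : ℝ) * (1 / √(b : ℝ)) else 0) := by
      intro a b
      split_ifs <;> positivity
    refine (sum_Icc_le_sum_sqPairs X
      (g := fun a => ∑ b ∈ Finset.Icc 1 X, (if oddOmega a + oddOmega b < K then
        1 / √(a : ℝ) * (1 / √(b : ℝ)) else 0))
      fun a => Finset.sum_nonneg fun b _ => hnn a b).trans ?_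
    refine Finset.sum_le_sum fun x hx => (sum_Icc_le_sum_sqPairs X (hnn _)).trans ?_
    refine Finset.sum_le_sum fun y hy => ?_
    rw [mem_sqPairs] at hx hy
    have h2 := card_primeFactors_le_oddOmega_add_one hx.2.1
    have h3 := card_primeFactors_le_oddOmega_add_one hy.2.1
    rw [oddOmega_sq_mul hx.1.1 hx.1.2, oddOmega_sq_mul hy.1.1 hy.1.2, one_div_sqrt_sq_mul,
      one_div_sqrt_sq_mul]
    simp only [G]
    split_ifs
    · exact le_rfl
    · omega
    · exact hww x y
    · exact le_rfl
  refine step1.trans ?_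
  set S := (sqPairs X).filter fun x => x.2 ^ 8 < X
  set T := (sqPairs X).filter fun x => X ≤ x.2 ^ 8 with hT
  have hsplit : ∀ f : ℕ × ℕ → ℝ,
      ∑ x ∈ sqPairs X, f x = ∑ x ∈ S, f x + ∑ x ∈ T, f x := by
    intro f
    rw [← Finset.sum_filter_add_sum_filter_not (sqPairs X) (fun x => x.2 ^ 8 < X)]
    simp only [not_lt, S, T]
  have hS := sum_sqWeight_small_le X
  have hall := sum_sqWeight_le X
  set e := (X : ℝ) ^ (1 / 8 : ℝ) * (1 + Real.log X)
  have he : 0 ≤ e := by positivity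
  have hS0 : 0 ≤ ∑ x ∈ S, sqWeight x := Finset.sum_nonneg fun x _ => sqWeight_nonneg x
  have hall0 : 0 ≤ ∑ x ∈ sqPairs X, sqWeight x := Finset.sum_nonneg fun x _ => sqWeight_nonneg x
  have hTall : ∑ x ∈ T, sqWeight x ≤ ∑ x ∈ sqPairs X, sqWeight x := by
    rw [hsplit]
    linarith
  have hprod : e * (4 * √X) + 4 * √X * e = 8 * √X * e := by ring
  rw [hsplit, ← hprod, add_assoc]
  refine add_le_add ?_ ?_
  · calc _ ≤ ∑ x ∈ S, ∑ y ∈ sqPairs X, sqWeight x * sqWeight y :=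
          Finset.sum_le_sum fun x _ => Finset.sum_le_sum fun y _ => hGle x y
      _ = (∑ x ∈ S, sqWeight x) * ∑ y ∈ sqPairs X, sqWeight y :=
          (Finset.sum_mul_sum _ _ _ _).symm
      _ ≤ _ := mul_le_mul hS hall hall0 he
  simp only [hsplit (G _), Finset.sum_add_distrib]
  refine add_le_add ?_ ?_
  · calc _ ≤ ∑ x ∈ T, ∑ y ∈ S, sqWeight x * sqWeight y :=
          Finset.sum_le_sum fun x _ => Finset.sum_le_sum fun y _ => hGle x y
      _ = (∑ x ∈ T, sqWeight x) * ∑ y ∈ S, sqWeight y :=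
          (Finset.sum_mul_sum _ _ _ _).symm
      _ ≤ _ := mul_le_mul (hTall.trans hall) hS hS0 (by positivity)
  set R : ℕ → Finset (ℕ × ℕ) := fun k =>
    (sqPairs X).filter (fun x => X ≤ x.2 ^ 8 ∧ x.2.primeFactors.card = k + 1) with hR
  set A : ℝ := 32 * Real.log 4 * √X / Real.log X with hA
  have hA0 : 0 ≤ A := by positivity
  have hV : ∀ k, ∑ x ∈ R k, sqWeight x ≤ A * (Q ^ k / k.factorial) := by
    intro k
    have h2 := sum_sqWeight_card_eq_le hX hQ k (h := fun _ => 1) fun _ => zero_le_one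
    simp only [one_mul] at h2
    refine h2.trans ?_
    calc _ ≤ 16 * Real.log 4 * √X / Real.log X * (Q ^ k / k.factorial) * 2 := by
          gcongr
          exact sum_one_div_sq_le X
      _ = _ := by rw [hA]; ring
  have hV0 : ∀ k, 0 ≤ ∑ x ∈ R k, sqWeight x := fun k =>
    Finset.sum_nonneg fun x _ => sqWeight_nonneg x
  have step2 : ∑ x ∈ T, ∑ y ∈ T, G x y = ∑ k ∈ Finset.range X, ∑ l ∈ Finset.range X,
      (if k + l < K then (∑ x ∈ R k, sqWeight x) * ∑ y ∈ R l, sqWeight y else 0) := by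
    rw [hT, sum_sqPairs_large_eq hX]
    refine Finset.sum_congr rfl fun k _ => ?_
    simp only [sum_sqPairs_large_eq hX (G _)]
    rw [Finset.sum_comm]
    refine Finset.sum_congr rfl fun l _ => ?_
    have h2 : ∀ x ∈ R k, ∀ y ∈ R l, G x y =
        if k + l < K then sqWeight x * sqWeight y else 0 := by
      intro x hx y hy
      rw [hR, Finset.mem_filter] at hx hy
      simp only [G, hx.2.2, hy.2.2]
      refine if_congr ?_ rfl rfl
      omega
    rw [Finset.sum_congr rfl fun x hx => Finset.sum_congr rfl (h2 x hx)]
    split_ifs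
    · rw [Finset.sum_mul_sum]
    · simp
  rw [step2]
  calc _ ≤ ∑ k ∈ Finset.range X, ∑ l ∈ Finset.range X, A ^ 2 *
        (if k + l < K then Q ^ k / k.factorial * (Q ^ l / l.factorial) else 0) := by
        refine Finset.sum_le_sum fun k _ => Finset.sum_le_sum fun l _ => ?_
        split_ifs
        · refine (mul_le_mul (hV k) (hV l) (hV0 l) (by positivity)).trans_eq ?_
          ring
        · simp
    _ ≤ A ^ 2 * ∑ s ∈ Finset.range K, (2 * Q) ^ s / s.factorial := by
        simp only [← Finset.mul_sum]
        exact mul_le_mul_of_nonneg_left (sum_add_lt_pow_div_factorial_le X K hQ0)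
          (by positivity)
    _ ≤ A ^ 2 * ∑ s ∈ Finset.range K, M * (2 * Real.log 2) ^ s := by
        gcongr with s _
        have : 2 * Q = K * (2 * Real.log 2) := by ring
        rw [this]
        exact mul_pow_div_factorial_le K s (by positivity)
    _ ≤ A ^ 2 * (M * ((2 * Real.log 2) ^ K / (2 * Real.log 2 - 1))) := by
        rw [← Finset.mul_sum, geom_sum_eq (by linarith)]
        gcongr
        linarith
    _ = _ := by
        have hXX : √(X : ℝ) ^ 2 = X := Real.sq_sqrt X.cast_nonneg
        rw [hA, div_pow, mul_pow (32 * Real.log 4), hXX]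
        ring

/-- The integers in the `y × y` multiplication table. -/
def multTable (y : ℕ) : Finset ℕ :=
  (Finset.Icc 1 y ×ˢ Finset.Icc 1 y).image fun x => x.1 * x.2

theorem mem_multTable {y u : ℕ} :
    u ∈ multTable y ↔ ∃ a b, (1 ≤ a ∧ a ≤ y) ∧ (1 ≤ b ∧ b ≤ y) ∧ a * b = u := by
  simp [multTable, and_assoc]

theorem sum_multTable_le (y K : ℕ) :
    ∑ u ∈ multTable y, 1 / √(u : ℝ) ≤
      ∑ n ∈ (Finset.Icc 1 (y ^ 2)).filter (fun n => K ≤ oddOmega n), 1 / √(n : ℝ) +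
      ∑ a ∈ Finset.Icc 1 y, ∑ b ∈ Finset.Icc 1 y,
        (if oddOmega a + oddOmega b < K then 1 / √(a : ℝ) * (1 / √(b : ℝ)) else 0) := by
  rw [← Finset.sum_filter_add_sum_filter_not (multTable y) (fun u => K ≤ oddOmega u)]
  refine add_le_add ?_ ?_
  · refine Finset.sum_le_sum_of_subset_of_nonneg ?_ fun _ _ _ => by positivity
    refine Finset.filter_subset_filter _ fun u hu => ?_
    rw [mem_multTable] at hu
    obtain ⟨a, b, ha, hb, rfl⟩ := hu
    rw [Finset.mem_Icc, sq]
    exact ⟨Nat.mul_pos ha.1 hb.1, Nat.mul_le_mul ha.2 hb.2⟩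
  · rw [Finset.sum_filter, multTable]
    refine (Finset.sum_image_le_of_nonneg
      (f := fun u : ℕ => if ¬ K ≤ oddOmega u then 1 / √(u : ℝ) else 0)
      fun u _ => by split_ifs <;> positivity).trans ?_
    rw [Finset.sum_product]
    refine Finset.sum_le_sum fun a ha => Finset.sum_le_sum fun b hb => ?_
    rw [Finset.mem_Icc] at ha hb
    rw [oddOmega_mul (by omega) (by omega)]
    simp only [not_le]
    split_ifs
    · push_cast
      rw [Real.sqrt_mul a.cast_nonneg, one_div_mul_one_div]
    · exact le_rfl

theorem erdosC_nonneg : 0 ≤ erdosC := by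
  have h0 := log_two_pos
  have h1 := Real.log_le_sub_one_of_pos h0
  rw [erdosC, sub_nonneg, div_le_one h0]
  linarith

theorem two_pow_rpow_erdosC (K : ℕ) :
    ((2 : ℝ) ^ K) ^ erdosC * (Real.exp 1 * Real.log 2) ^ K = 2 ^ K := by
  have h0 := log_two_pos
  have h1 : (2 : ℝ) ^ erdosC * (Real.exp 1 * Real.log 2) = 2 := by
    rw [Real.rpow_def_of_pos (by norm_num)]
    nth_rw 2 [← Real.exp_log h0]
    rw [← Real.exp_add, ← Real.exp_add, erdosC]
    conv_rhs => rw [← Real.exp_log (show (0 : ℝ) < 2 by norm_num)]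
    congr 1
    field_simp
    ring
  rw [← Real.rpow_natCast, ← Real.rpow_mul (by norm_num), mul_comm (K : ℝ),
    Real.rpow_mul (by norm_num), Real.rpow_natCast, ← mul_pow, h1, Real.rpow_natCast]

theorem pow_self_div_factorial_le {K : ℕ} (hK : 1 ≤ K) :
    (K : ℝ) ^ K / K.factorial ≤ Real.exp 1 ^ K / √K := by
  have h := Stirling.le_factorial_stirling K
  have hK0 : (0 : ℝ) < K := by exact_mod_cast hK
  have h1 : √(K : ℝ) ≤ √(2 * Real.pi * K) :=
    Real.sqrt_le_sqrt (by nlinarith [Real.pi_gt_three])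
  have h2 : √(K : ℝ) * (K / Real.exp 1) ^ K ≤ K.factorial :=
    (mul_le_mul_of_nonneg_right h1 (by positivity)).trans h
  have h3 : 0 < √(K : ℝ) := Real.sqrt_pos.2 hK0
  rw [div_le_div_iff₀ (by positivity) h3]
  rw [div_pow, ← mul_div_assoc, div_le_iff₀ (by positivity)] at h2
  linarith

theorem exists_sum_multTable_le :
    ∃ C : ℝ, ∀ y : ℕ, 3 ≤ y →
      (∑ u ∈ multTable y, 1 / √(u : ℝ)) * Real.log y ^ erdosC / y ≤
        C / √(Real.log (2 * Real.log y)) +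
          27 * (Real.log y ^ (1 + erdosC) / (y : ℝ) ^ (3 / 8 : ℝ)) := by
  obtain ⟨D, hD0, hD⟩ := exists_sum_one_div_prime_le
  obtain ⟨CA, hCA0, hCA⟩ := exists_sum_many_prime_factors_le
  obtain ⟨CB, hCB0, hCB⟩ := exists_sum_few_prime_factors_le
  set E := Real.exp D with hE
  have hE1 : 1 ≤ E := Real.one_le_exp hD0
  refine ⟨(CA + 8 * CB * E) * (2 * E), fun y hy => ?_⟩
  have hy0 : (0 : ℝ) < y := by positivity
  have hy3 : (3 : ℝ) ≤ y := by exact_mod_cast hy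
  have hlog : 1 ≤ Real.log y := by
    rw [Real.le_log_iff_exp_le hy0]
    exact Real.exp_one_lt_three.le.trans hy3
  set l := Real.log y with hl
  have hl2 : Real.log ((y ^ 2 : ℕ) : ℝ) = 2 * l := by
    push_cast
    rw [Real.log_pow, ← hl]
    norm_num
  obtain ⟨n, hn1, hn2⟩ := exists_nat_pow_near (x := 2 * l * E) (y := 2)
    (by nlinarith) (by norm_num)
  set K := n + 1 with hK
  have hKup : (2 : ℝ) ^ K ≤ 2 * (2 * l * E) := by
    rw [hK, pow_succ]
    linarith
  have hKl : 2 * l ≤ (2 : ℝ) ^ K := by nlinarith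
  have hP : ∑ p ∈ (y ^ 2).primesLE, (1 : ℝ) / p ≤ K * Real.log 2 := by
    refine (hD (y ^ 2) (by nlinarith)).trans ?_
    rw [hl2, ← Real.log_pow]
    have : Real.log (2 * l) + D = Real.log (2 * l * E) := by
      rw [Real.log_mul (x := 2 * l) (y := E) (by positivity) (by positivity), hE, Real.log_exp]
    rw [this]
    exact Real.log_le_log (by positivity) hn2.le
  have hP' : ∑ p ∈ y.primesLE, (1 : ℝ) / p ≤ K * Real.log 2 :=
    (Finset.sum_le_sum_of_subset_of_nonneg (Nat.primesLE_mono (Nat.le_self_pow (by norm_num) y))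
      fun _ _ _ => by positivity).trans hP
  have hA := hCA (y ^ 2) K (by nlinarith) hP
  have hB := hCB y K (by omega) hP'
  have hsum := (sum_multTable_le y K).trans (add_le_add hA hB)
  have hlogK : Real.log (2 * l) ≤ K := by
    have h1 : Real.log (2 * l) ≤ K * Real.log 2 := by
      rw [← Real.log_pow]
      exact Real.log_le_log (by positivity) hKl
    have : (0 : ℝ) ≤ K := K.cast_nonneg
    nlinarith [log_two_lt_one]
  have hloglog : 0 < Real.log (2 * l) := Real.log_pos (by linarith)
  set M : ℝ := (K : ℝ) ^ K / K.factorial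
  have hlc : l ^ erdosC ≤ ((2 : ℝ) ^ K) ^ erdosC :=
    Real.rpow_le_rpow (by linarith) (by linarith) erdosC_nonneg
  have h0 := log_two_pos
  have hmain : M * Real.log 2 ^ K * l ^ erdosC ≤
      2 * (2 * l * E) / √(Real.log (2 * l)) := by
    calc M * Real.log 2 ^ K * l ^ erdosC
        ≤ Real.exp 1 ^ K / √K * Real.log 2 ^ K * ((2 : ℝ) ^ K) ^ erdosC := by
          gcongr
          exact pow_self_div_factorial_le (by omega)
      _ = (((2 : ℝ) ^ K) ^ erdosC * (Real.exp 1 * Real.log 2) ^ K) / √K := by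
          rw [mul_pow]
          ring
      _ = 2 ^ K / √K := by rw [two_pow_rpow_erdosC]
      _ ≤ _ := by
          gcongr
  have hexcA : ((y ^ 2 : ℕ) : ℝ) ^ (1 / 8 : ℝ) * (1 + Real.log ((y ^ 2 : ℕ) : ℝ)) ≤
      (y : ℝ) ^ (5 / 8 : ℝ) * (3 * l) := by
    rw [hl2]
    have : ((y ^ 2 : ℕ) : ℝ) ^ (1 / 8 : ℝ) = (y : ℝ) ^ (1 / 4 : ℝ) := by
      push_cast
      rw [← Real.rpow_natCast, ← Real.rpow_mul hy0.le]
      norm_num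
    rw [this]
    have : (y : ℝ) ^ (1 / 4 : ℝ) ≤ (y : ℝ) ^ (5 / 8 : ℝ) :=
      Real.rpow_le_rpow_of_exponent_le (by linarith) (by norm_num)
    gcongr
    linarith
  have hexcB : 8 * √y * ((y : ℝ) ^ (1 / 8 : ℝ) * (1 + l)) ≤
      8 * ((y : ℝ) ^ (5 / 8 : ℝ) * (3 * l)) := by
    have : √(y : ℝ) * (y : ℝ) ^ (1 / 8 : ℝ) = (y : ℝ) ^ (5 / 8 : ℝ) := by
      rw [Real.sqrt_eq_rpow, ← Real.rpow_add hy0]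
      norm_num
    rw [← this]
    have h2 : 0 ≤ √(y : ℝ) * (y : ℝ) ^ (1 / 8 : ℝ) := by positivity
    nlinarith
  have hmainA : CA * √((y ^ 2 : ℕ) : ℝ) / Real.log ((y ^ 2 : ℕ) : ℝ) *
      (M * Real.log 2 ^ K) = CA * y / (2 * l) * (M * Real.log 2 ^ K) := by
    rw [hl2]
    push_cast
    rw [Real.sqrt_sq hy0.le]
  have hmainB : CB * y / l ^ 2 * (M * (2 * Real.log 2) ^ K) ≤
      8 * CB * E * y / (2 * l) * (M * Real.log 2 ^ K) := by
    calc CB * y / l ^ 2 * (M * (2 * Real.log 2) ^ K)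
        = CB * y / l ^ 2 * (M * Real.log 2 ^ K) * 2 ^ K := by rw [mul_pow]; ring
      _ ≤ CB * y / l ^ 2 * (M * Real.log 2 ^ K) * (2 * (2 * l * E)) := by gcongr
      _ = _ := by
          field_simp
          ring
  rw [hmainA] at hsum
  have htot : ∑ u ∈ multTable y, 1 / √(u : ℝ) ≤
      27 * ((y : ℝ) ^ (5 / 8 : ℝ) * l) +
        (CA + 8 * CB * E) * y / (2 * l) * (M * Real.log 2 ^ K) := by
    have : (CA + 8 * CB * E) * y / (2 * l) * (M * Real.log 2 ^ K) =
      CA * y / (2 * l) * (M * Real.log 2 ^ K) +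
        8 * CB * E * y / (2 * l) * (M * Real.log 2 ^ K) := by ring
    rw [this]
    linarith
  calc (∑ u ∈ multTable y, 1 / √(u : ℝ)) * l ^ erdosC / y
      ≤ (27 * ((y : ℝ) ^ (5 / 8 : ℝ) * l) +
        (CA + 8 * CB * E) * y / (2 * l) * (M * Real.log 2 ^ K)) * l ^ erdosC / y := by
        gcongr
    _ = 27 * ((y : ℝ) ^ (5 / 8 : ℝ) / y * (l * l ^ erdosC)) +
        (CA + 8 * CB * E) / (2 * l) * (M * Real.log 2 ^ K * l ^ erdosC) := by
        field_simp
    _ ≤ 27 * ((y : ℝ) ^ (5 / 8 : ℝ) / y * (l * l ^ erdosC)) +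
        (CA + 8 * CB * E) / (2 * l) * (2 * (2 * l * E) / √(Real.log (2 * l))) := by
        gcongr
    _ = _ := by
        have h1 : (y : ℝ) ^ (5 / 8 : ℝ) / y = 1 / (y : ℝ) ^ (3 / 8 : ℝ) := by
          rw [div_eq_div_iff hy0.ne' (by positivity), ← Real.rpow_add hy0]
          norm_num
        rw [h1, Real.rpow_add (by linarith), Real.rpow_one]
        have : 0 < √(Real.log (2 * l)) := Real.sqrt_pos.2 hloglog
        field_simp
        ring

/-- The weighted Erdős multiplication table estimate. -/
theorem tendsto_sum_multTable :
    Tendsto (fun y : ℕ => (∑ u ∈ multTable y, 1 / √(u : ℝ)) * Real.log y ^ erdosC / y)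
      atTop (nhds 0) := by
  obtain ⟨C, hC⟩ := exists_sum_multTable_le
  have h1 : Tendsto (fun y : ℕ => C / √(Real.log (2 * Real.log (y : ℝ)))) atTop (nhds 0) := by
    refine Tendsto.const_div_atTop ?_ C
    refine Real.tendsto_sqrt_atTop.comp (Real.tendsto_log_atTop.comp ?_)
    exact (Real.tendsto_log_atTop.comp tendsto_natCast_atTop_atTop).const_mul_atTop two_pos
  have h2 : Tendsto (fun y : ℕ => 27 * (Real.log (y : ℝ) ^ (1 + erdosC) /
      (y : ℝ) ^ (3 / 8 : ℝ))) atTop (nhds 0) := by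
    have := (isLittleO_log_rpow_rpow_atTop (1 + erdosC)
      (show (0 : ℝ) < 3 / 8 by norm_num)).tendsto_div_nhds_zero
    simpa using (this.comp tendsto_natCast_atTop_atTop).const_mul 27
  have h3 := h1.add h2
  rw [add_zero] at h3
  refine squeeze_zero' (Eventually.of_forall fun y => ?_)
    (eventually_atTop.2 ⟨3, fun y hy => hC y hy⟩) h3
  have := Real.rpow_nonneg (Real.log_natCast_nonneg y) erdosC
  positivity

/-- The slopes `α ∈ [1/H, H]` for which `α u` and `v` are closer than `δ`, for some `u` and `v`
in the `y × y` multiplication table. -/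
def closeSlopes (H y : ℕ) (δ : ℝ) : Set ℝ :=
  {α | (1 / (H : ℝ) ≤ α ∧ α ≤ H) ∧ ∃ u ∈ multTable y, ∃ v ∈ multTable y, |α * u - v| < δ}

theorem one_le_of_mem_multTable {y u : ℕ} (hu : u ∈ multTable y) : 1 ≤ u := by
  obtain ⟨a, b, ha, hb, rfl⟩ := mem_multTable.1 hu
  exact Nat.mul_pos ha.1 hb.1

theorem volume_closeSlopes_le (H y : ℕ) {δ : ℝ} (hδ0 : 0 ≤ δ) (hδ : δ ≤ 1) :
    volume (closeSlopes H y δ) ≤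
      ENNReal.ofReal (2 * δ * √((H : ℝ) + 1) * (∑ u ∈ multTable y, 1 / √(u : ℝ)) ^ 2) := by
  set I : ℕ → ℕ → Set ℝ := fun u v =>
    if (v : ℝ) ≤ (H + 1) * u then Set.Ioo ((v - δ) / (u : ℝ)) ((v + δ) / u) else ∅
  have hsub : closeSlopes H y δ ⊆ ⋃ u ∈ multTable y, ⋃ v ∈ multTable y, I u v := by
    rintro α ⟨⟨-, h2⟩, u, hu, v, hv, huv⟩
    have hu1 : (1 : ℝ) ≤ u := by exact_mod_cast one_le_of_mem_multTable hu
    have hu0 : (0 : ℝ) < u := by linarith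
    rw [abs_sub_lt_iff] at huv
    simp only [Set.mem_iUnion]
    refine ⟨u, hu, v, hv, ?_⟩
    have : (v : ℝ) ≤ (H + 1) * u := by nlinarith
    simp only [I, if_pos this, Set.mem_Ioo]
    rw [div_lt_iff₀ hu0, lt_div_iff₀ hu0]
    constructor <;> linarith
  have hI : ∀ u ∈ multTable y, ∀ v ∈ multTable y,
      volume (I u v) ≤
        ENNReal.ofReal (2 * δ * √((H : ℝ) + 1) * (1 / √(u : ℝ) * (1 / √(v : ℝ)))) := by
    intro u hu v hv
    have hu1 : (1 : ℝ) ≤ u := by exact_mod_cast one_le_of_mem_multTable hu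
    have hv1 : (1 : ℝ) ≤ v := by exact_mod_cast one_le_of_mem_multTable hv
    have hu0 : 0 < √(u : ℝ) := Real.sqrt_pos.2 (by linarith)
    have hv0 : 0 < √(v : ℝ) := Real.sqrt_pos.2 (by linarith)
    simp only [I]
    split_ifs with h
    · rw [Real.volume_Ioo]
      refine ENNReal.ofReal_le_ofReal ?_
      have h1 : √(v : ℝ) ≤ √((H : ℝ) + 1) * √u := by
        rw [← Real.sqrt_mul (by positivity)]
        exact Real.sqrt_le_sqrt h
      have h2 : (v + δ) / (u : ℝ) - (v - δ) / u = 2 * δ * (1 / (√(u : ℝ) * √u)) := by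
        rw [Real.mul_self_sqrt (by linarith)]
        ring
      rw [h2, mul_assoc (2 * δ)]
      refine mul_le_mul_of_nonneg_left ?_ (by positivity)
      rw [one_div_mul_one_div, mul_one_div, div_le_div_iff₀ (by positivity) (by positivity)]
      nlinarith
    · simp
  calc volume (closeSlopes H y δ)
      ≤ ∑ u ∈ multTable y, ∑ v ∈ multTable y, volume (I u v) :=
        (measure_mono hsub).trans ((measure_biUnion_finset_le _ _).trans
          (Finset.sum_le_sum fun u _ => measure_biUnion_finset_le _ _))
    _ ≤ ∑ u ∈ multTable y, ∑ v ∈ multTable y,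
        ENNReal.ofReal (2 * δ * √((H : ℝ) + 1) * (1 / √(u : ℝ) * (1 / √(v : ℝ)))) :=
        Finset.sum_le_sum fun u hu => Finset.sum_le_sum fun v hv => hI u hu v hv
    _ = _ := by
        simp_rw [sq, Finset.sum_mul_sum, Finset.mul_sum]
        rw [ENNReal.ofReal_sum_of_nonneg fun _ _ => Finset.sum_nonneg fun _ _ => by positivity]
        refine Finset.sum_congr rfl fun u _ => ?_
        rw [ENNReal.ofReal_sum_of_nonneg fun _ _ => by positivity]

/-- The lower bound `(log N)^(2c) / N` for the gaps. -/
noncomputable def gapBound (N : ℕ) : ℝ := L N ^ (2 * erdosC) / (N : ℝ)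

theorem gapBound_nonneg (N : ℕ) : 0 ≤ gapBound N :=
  div_nonneg (Real.rpow_nonneg (zero_le_one.trans (le_max_left _ _)) _) N.cast_nonneg

theorem tendsto_gapBound_mul_sum_sq (H : ℕ) :
    Tendsto (fun s : ℕ => gapBound (s ^ 2 - 1) *
      (∑ u ∈ multTable (2 * (H + 1) * s), 1 / √(u : ℝ)) ^ 2) atTop (nhds 0) := by
  have hy : Tendsto (fun s : ℕ => 2 * (H + 1) * s) atTop atTop :=
    tendsto_id.const_mul_atTop' (by omega)
  have h := ((tendsto_sum_multTable.comp hy).pow 2).const_mul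
    ((2 : ℝ) ^ (2 * erdosC) * (8 * ((H : ℝ) + 1) ^ 2))
  rw [zero_pow two_ne_zero, mul_zero] at h
  refine squeeze_zero' (Eventually.of_forall fun s =>
    mul_nonneg (gapBound_nonneg _) (sq_nonneg _)) (eventually_atTop.2 ⟨2, fun s hs => ?_⟩) h
  simp only [Function.comp]
  set y := 2 * (H + 1) * s with hydef
  set S := ∑ u ∈ multTable y, 1 / √(u : ℝ)
  have hsy : s ≤ y := Nat.le_mul_of_pos_left s (by omega)
  have hy4 : 4 ≤ y := by nlinarith
  have hs2 : (2 : ℝ) ≤ s := by exact_mod_cast hs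
  have hsyR : (s : ℝ) ≤ y := by exact_mod_cast hsy
  have hyR : (y : ℝ) = 2 * ((H : ℝ) + 1) * s := by rw [hydef]; push_cast; ring
  have hy4R : (4 : ℝ) ≤ y := by exact_mod_cast hy4
  have hN : ((s ^ 2 - 1 : ℕ) : ℝ) = (s : ℝ) ^ 2 - 1 := by
    rw [Nat.cast_sub (by nlinarith)]
    push_cast
    rfl
  have hlogy : 1 ≤ Real.log y := by
    rw [Real.le_log_iff_exp_le (by linarith)]
    linarith [Real.exp_one_lt_three]
  have hL : L ((s ^ 2 - 1 : ℕ) : ℝ) ≤ 2 * Real.log y := by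
    refine max_le (by linarith) ?_
    have : 2 * Real.log y = Real.log ((y : ℝ) ^ 2) := by rw [Real.log_pow]; norm_num
    rw [this, hN]
    exact Real.log_le_log (by nlinarith) (by nlinarith)
  have hL1 : 0 ≤ L ((s ^ 2 - 1 : ℕ) : ℝ) := zero_le_one.trans (le_max_left _ _)
  have hgap : gapBound (s ^ 2 - 1) ≤
      (2 : ℝ) ^ (2 * erdosC) * (Real.log y ^ erdosC) ^ 2 *
        (8 * ((H : ℝ) + 1) ^ 2 / (y : ℝ) ^ 2) := by
    calc gapBound (s ^ 2 - 1) ≤ (2 * Real.log y) ^ (2 * erdosC) / ((s : ℝ) ^ 2 / 2) := by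
          rw [gapBound]
          have := erdosC_nonneg
          gcongr
          rw [hN]
          nlinarith
      _ = _ := by
          rw [Real.mul_rpow (by norm_num) (by linarith), hyR, mul_comm 2 erdosC,
            Real.rpow_mul (x := Real.log _) (by rw [← hyR]; linarith), Real.rpow_two]
          field_simp
          ring
  calc gapBound (s ^ 2 - 1) * S ^ 2 ≤ _ := mul_le_mul_of_nonneg_right hgap (sq_nonneg _)
    _ = _ := by ring

theorem one_le_sum_multTable {y : ℕ} (hy : 1 ≤ y) : 1 ≤ ∑ u ∈ multTable y, 1 / √(u : ℝ) := by
  have h := Finset.single_le_sum (f := fun u : ℕ => 1 / √(u : ℝ)) (s := multTable y)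
    (fun _ _ => by positivity) (mem_multTable.2 ⟨1, 1, ⟨le_rfl, hy⟩, ⟨le_rfl, hy⟩, rfl⟩)
  simpa using h

theorem tendsto_gapBound : Tendsto (fun s : ℕ => gapBound (s ^ 2 - 1)) atTop (nhds 0) := by
  refine squeeze_zero' (Eventually.of_forall fun s => gapBound_nonneg _)
    (eventually_atTop.2 ⟨1, fun s hs => ?_⟩) (tendsto_gapBound_mul_sum_sq 0)
  exact le_mul_of_one_le_right (gapBound_nonneg _)
    (one_le_pow₀ (one_le_sum_multTable (by omega)))

theorem tendsto_volume_closeSlopes (H : ℕ) :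
    Tendsto (fun s : ℕ => volume (closeSlopes H (2 * (H + 1) * s) (gapBound (s ^ 2 - 1))))
      atTop (nhds 0) := by
  have h := ENNReal.tendsto_ofReal
    ((tendsto_gapBound_mul_sum_sq H).const_mul (2 * √((H : ℝ) + 1)))
  rw [mul_zero, ENNReal.ofReal_zero] at h
  refine tendsto_of_tendsto_of_tendsto_of_le_of_le' tendsto_const_nhds h
    (Eventually.of_forall fun _ => zero_le) ?_
  filter_upwards [tendsto_gapBound.eventually_le_const one_pos] with s hs
  refine (volume_closeSlopes_le H _ (gapBound_nonneg _) hs).trans_eq ?_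
  congr 1
  ring

theorem ae_frequently_notMem_of_tendsto {X : Type*} [MeasurableSpace X] {μ : Measure X}
    {A : ℕ → Set X} (hA : Tendsto (fun s => μ (A s)) atTop (nhds 0)) :
    ∀ᵐ x ∂μ, ∃ᶠ s in atTop, x ∉ A s := by
  have h0 : μ (⋃ n, ⋂ s ≥ n, A s) = 0 := by
    rw [measure_iUnion_null_iff]
    intro n
    refine le_antisymm (ge_of_tendsto hA (eventually_atTop.2 ⟨n, fun s hs => ?_⟩)) zero_le
    exact measure_mono (Set.biInter_subset_of_mem hs)
  filter_upwards [measure_eq_zero_iff_ae_notMem.1 h0] with x hx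
  simp only [Set.mem_iUnion, Set.mem_iInter, not_exists] at hx
  rw [frequently_atTop]
  intro n
  have := hx n
  push Not at this
  exact this

theorem Irrational.eq_and_eq_of_mul_sq_add_sq_eq {α : ℝ} (hα : Irrational α) {m n m' n' : ℕ}
    (h : α * (m : ℝ) ^ 2 + (n : ℝ) ^ 2 = α * (m' : ℝ) ^ 2 + (n' : ℝ) ^ 2) : m = m' ∧ n = n' := by
  have hm : m = m' := by
    by_contra hne
    have hsq : (m : ℝ) ^ 2 - (m' : ℝ) ^ 2 ≠ 0 := by
      rw [sub_ne_zero]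
      exact_mod_cast fun h => hne (Nat.pow_left_injective two_ne_zero h)
    refine hα ⟨((n' : ℚ) ^ 2 - (n : ℚ) ^ 2) / ((m : ℚ) ^ 2 - (m' : ℚ) ^ 2), ?_⟩
    push_cast
    rw [div_eq_iff hsq]
    linarith
  subst hm
  refine ⟨rfl, Nat.pow_left_injective two_ne_zero ?_⟩
  have := add_left_cancel h
  exact_mod_cast this

theorem le_sub_of_notMem_closeSlopes {α δ : ℝ} {H s : ℕ} (hH : 1 ≤ H)
    (h1 : 1 / (H : ℝ) ≤ α) (h2 : α ≤ H) (hδ : δ ≤ 1 / (H : ℝ))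
    (hα : α ∉ closeSlopes H (2 * (H + 1) * s) δ) {m n m' n' : ℕ}
    (hle : α * (m : ℝ) ^ 2 + (n : ℝ) ^ 2 ≤ (H + 1) * (s : ℝ) ^ 2)
    (hlt : α * (m' : ℝ) ^ 2 + (n' : ℝ) ^ 2 < α * (m : ℝ) ^ 2 + (n : ℝ) ^ 2) :
    δ ≤ α * (m : ℝ) ^ 2 + (n : ℝ) ^ 2 - (α * (m' : ℝ) ^ 2 + (n' : ℝ) ^ 2) := by
  have hHR : (1 : ℝ) ≤ H := by exact_mod_cast hH
  have hα0 : 0 < α := lt_of_lt_of_le (by positivity) h1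
  have hHα : 1 ≤ α * H := (div_le_iff₀ (by linarith)).1 h1
  have hδ1 : δ ≤ 1 := hδ.trans ((div_le_one (by linarith)).2 hHR)
  have bound (a b : ℕ) (hab : α * (a : ℝ) ^ 2 + (b : ℝ) ^ 2 ≤ (H + 1) * (s : ℝ) ^ 2) :
      a ≤ (H + 1) * s ∧ b ≤ (H + 1) * s := by
    have ha : (a : ℝ) ^ 2 ≤ (((H : ℝ) + 1) * s) ^ 2 := by
      have : (a : ℝ) ^ 2 ≤ H * (α * (a : ℝ) ^ 2) := by nlinarith [sq_nonneg (a : ℝ)]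
      have : H * (α * (a : ℝ) ^ 2) ≤ H * ((H + 1) * (s : ℝ) ^ 2) :=
        mul_le_mul_of_nonneg_left (by nlinarith [sq_nonneg (b : ℝ)]) (by linarith)
      have : 0 ≤ ((H : ℝ) + 1) * (s : ℝ) ^ 2 := by positivity
      nlinarith
    have hb : (b : ℝ) ^ 2 ≤ (((H : ℝ) + 1) * s) ^ 2 := by
      have : 0 ≤ α * (a : ℝ) ^ 2 := by positivity
      have : 0 ≤ ((H : ℝ) + 1) * (s : ℝ) ^ 2 := by positivity
      nlinarith
    constructor
    · exact_mod_cast (pow_le_pow_iff_left₀ (by positivity) (by positivity) two_ne_zero).1 ha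
    · exact_mod_cast (pow_le_pow_iff_left₀ (by positivity) (by positivity) two_ne_zero).1 hb
  obtain ⟨bm, bn⟩ := bound m n hle
  obtain ⟨bm', bn'⟩ := bound m' n' (hlt.le.trans hle)
  have hmem (a b : ℕ) (hab : a < b) (hb : b ≤ (H + 1) * s) :
      b ^ 2 - a ^ 2 ∈ multTable (2 * (H + 1) * s) := by
    rw [mem_multTable, Nat.sq_sub_sq]
    have : 2 * (H + 1) * s = 2 * ((H + 1) * s) := by ring
    exact ⟨b + a, b - a, ⟨by omega, by omega⟩, ⟨by omega, by omega⟩, rfl⟩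
  have hcast (a b : ℕ) (hab : a < b) : ((b ^ 2 - a ^ 2 : ℕ) : ℝ) = (b : ℝ) ^ 2 - (a : ℝ) ^ 2 := by
    rw [Nat.cast_sub (Nat.pow_le_pow_left hab.le 2)]
    push_cast
    rfl
  have hfar (u v : ℕ) (hu : u ∈ multTable (2 * (H + 1) * s))
      (hv : v ∈ multTable (2 * (H + 1) * s)) : δ ≤ |α * u - v| := by
    by_contra! h
    exact hα ⟨⟨h1, h2⟩, u, hu, v, hv, h⟩
  have hsq (a b : ℕ) (hab : a < b) : (a : ℝ) ^ 2 + 1 ≤ (b : ℝ) ^ 2 := by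
    exact_mod_cast Nat.pow_lt_pow_left hab two_ne_zero
  rcases lt_trichotomy m m' with h | rfl | h
  · rcases lt_or_ge n' n with h' | h'
    · have := hfar _ _ (hmem m m' h bm') (hmem n' n h' bn)
      rw [hcast _ _ h, hcast _ _ h', abs_of_nonpos (by linarith)] at this
      linarith
    · have := hsq _ _ h
      have : (n : ℝ) ^ 2 ≤ (n' : ℝ) ^ 2 := by gcongr
      nlinarith
  · rcases lt_or_ge n' n with h' | h'
    · linarith [hsq _ _ h']
    · have : (n : ℝ) ^ 2 ≤ (n' : ℝ) ^ 2 := by gcongr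
      linarith
  · rcases lt_or_ge n n' with h' | h'
    · have := hfar _ _ (hmem m' m h bm) (hmem n n' h' bn')
      rw [hcast _ _ h, hcast _ _ h', abs_of_nonneg (by linarith)] at this
      linarith
    · have := hsq _ _ h
      have : (n' : ℝ) ^ 2 ≤ (n : ℝ) ^ 2 := by gcongr
      nlinarith

theorem IsSpectrumEnum.apply_sq_le {α : ℝ} {lam : ℕ → ℝ} (hlam : IsSpectrumEnum α lam)
    (hα : Irrational α) (hα0 : 0 < α) {s : ℕ} (hs : 1 ≤ s) :
    lam (s ^ 2) ≤ (α + 1) * (s : ℝ) ^ 2 := by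
  obtain ⟨hmono, -, hset⟩ := hlam
  by_contra! hlt
  have hex (x : ℕ × ℕ) (h1 : 1 ≤ x.1) (h2 : 1 ≤ x.2) :
      ∃ k, 1 ≤ k ∧ lam k = α * (x.1 : ℝ) ^ 2 + (x.2 : ℝ) ^ 2 :=
    hset.ge ⟨x.1, x.2, h1, h2, rfl⟩
  choose! f hf1 hf2 using hex
  have hmaps : ∀ x ∈ Finset.Icc 1 s ×ˢ Finset.Icc 1 s, f x ∈ Finset.Ico 1 (s ^ 2) := by
    intro x hx
    simp only [Finset.mem_product, Finset.mem_Icc] at hx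
    obtain ⟨⟨ha, ha'⟩, hb, hb'⟩ := hx
    refine Finset.mem_Ico.2 ⟨hf1 x ha hb, ?_⟩
    by_contra! hge
    have h1 : lam (s ^ 2) ≤ lam (f x) := by
      rcases hge.eq_or_lt with h | h
      · rw [h]
      · exact (hmono _ _ (Nat.pow_pos hs) h).le
    rw [hf2 x ha hb] at h1
    have h2 : (x.1 : ℝ) ^ 2 ≤ (s : ℝ) ^ 2 := by gcongr
    have h3 : (x.2 : ℝ) ^ 2 ≤ (s : ℝ) ^ 2 := by gcongr
    nlinarith
  have hcard : (Finset.Ico 1 (s ^ 2)).card < (Finset.Icc 1 s ×ˢ Finset.Icc 1 s).card := by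
    have : 0 < s ^ 2 := Nat.pow_pos hs
    rw [Finset.card_product, Nat.card_Icc, Nat.card_Ico, Nat.add_sub_cancel, ← sq]
    omega
  obtain ⟨x, hx, x', hx', hne, heq⟩ :=
    Finset.exists_ne_map_eq_of_card_lt_of_maps_to hcard hmaps
  simp only [Finset.mem_product, Finset.mem_Icc] at hx hx'
  have h := hf2 x hx.1.1 hx.2.1
  rw [heq, hf2 x' hx'.1.1 hx'.2.1] at h
  obtain ⟨h1, h2⟩ := hα.eq_and_eq_of_mul_sq_add_sq_eq h
  exact hne (Prod.ext h1.symm h2.symm)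

theorem IsSpectrumEnum.le_bDeltaMin {α δ : ℝ} {lam : ℕ → ℝ} (hlam : IsSpectrumEnum α lam)
    (hirr : Irrational α) {H s : ℕ} (hH : 1 ≤ H) (hs : 2 ≤ s)
    (h1 : 1 / (H : ℝ) ≤ α) (h2 : α ≤ H) (hδ : δ ≤ 1 / (H : ℝ))
    (hα : α ∉ closeSlopes H (2 * (H + 1) * s) δ) :
    δ ≤ bDeltaMin lam (s ^ 2 - 1) := by
  have hα0 : 0 < α := lt_of_lt_of_le (by positivity) h1
  have hs4 : 4 ≤ s ^ 2 := by nlinarith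
  have htop := hlam.apply_sq_le hirr hα0 (by omega : 1 ≤ s)
  obtain ⟨hmono, -, hset⟩ := hlam
  refine le_csInf ⟨_, 1, le_rfl, by omega, rfl⟩ ?_
  rintro x ⟨k, hk1, hk2, rfl⟩
  obtain ⟨m, n, -, -, hmn⟩ := hset.le ⟨k + 1, by omega, rfl⟩
  obtain ⟨m', n', -, -, hmn'⟩ := hset.le ⟨k, hk1, rfl⟩
  have hlt := hmono k (k + 1) hk1 k.lt_succ_self
  have hle : lam (k + 1) ≤ (H + 1) * (s : ℝ) ^ 2 := by
    have h3 : lam (k + 1) ≤ lam (s ^ 2) := by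
      rcases (show k + 1 ≤ s ^ 2 by omega).eq_or_lt with h | h
      · rw [h]
      · exact (hmono _ _ (by omega) h).le
    refine (h3.trans htop).trans ?_
    gcongr
  rw [hmn, hmn'] at hlt ⊢
  rw [hmn] at hle
  exact le_sub_of_notMem_closeSlopes hH h1 h2 hδ hα hle hlt

theorem ae_irrational : ∀ᵐ α ∂(volume : Measure ℝ), Irrational α :=
  (Set.countable_range ((↑) : ℚ → ℝ)).ae_notMem volume

theorem stmt13 :
    ∀ᵐ α ∂(volume : Measure ℝ), 0 < α →
      ∀ lam : ℕ → ℝ, IsSpectrumEnum α lam →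
        ∃ᶠ N in atTop, bDeltaMin lam N ≥ (L N) ^ (2 * erdosC) / (N : ℝ) := by
  have hae : ∀ᵐ α ∂(volume : Measure ℝ), ∀ H : ℕ, ∃ᶠ s : ℕ in atTop,
      α ∉ closeSlopes H (2 * (H + 1) * s) (gapBound (s ^ 2 - 1)) :=
    ae_all_iff.2 fun H => ae_frequently_notMem_of_tendsto (tendsto_volume_closeSlopes H)
  filter_upwards [hae, ae_irrational] with α hα hirr hα0 lam hlam
  obtain ⟨H, hH⟩ := exists_nat_ge (max α (max (1 / α) 1))
  have hH1 : (1 : ℝ) ≤ H := (le_max_right _ _).trans ((le_max_right _ _).trans hH)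
  have hHα : 1 / α ≤ H := (le_max_left _ _).trans ((le_max_right _ _).trans hH)
  have hsmall := tendsto_gapBound.eventually_le_const
    (show (0 : ℝ) < 1 / H by positivity)
  have hfreq := (hα H).and_eventually (hsmall.and (eventually_ge_atTop 2))
  have hN : Tendsto (fun s : ℕ => s ^ 2 - 1) atTop atTop := by
    refine tendsto_atTop_mono' atTop (eventually_atTop.2 ⟨2, fun s hs => ?_⟩) tendsto_id
    have : 2 * s ≤ s ^ 2 := by nlinarith
    simp only [id]
    omega
  refine hN.frequently (hfreq.mono fun s ⟨h, hδ, hs⟩ => ?_)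
  exact hlam.le_bDeltaMin hirr (by exact_mod_cast hH1) hs ((one_div_le hα0 (by linarith)).1 hHα)
    ((le_max_left _ _).trans hH) hδ h
end

section
/- Let a_n = p_n be the n-th prime, and let C_N = #(A_N − A_N) where A_N = {p_1, …, p_N}. Then there exist constants c₁, c₂ > 0 and N₀ such that for all N ≥ N₀ one has c₁ · N log N ≤ C_N ≤ c₂ · N log N. -/
/-- `C_N = #(A_N - A_N)` where `A_N = {a_1, …, a_N}`. -/
noncomputable def diffCard (a : ℕ → ℕ) (N : ℕ) : ℕ :=
  (((Finset.Icc 1 N) ×ˢ (Finset.Icc 1 N)).image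
    (fun p : ℕ × ℕ => (a p.1 : ℤ) - (a p.2 : ℤ))).card

/-- The `n`-th prime number (`nthPrime 1 = 2`). -/
noncomputable def nthPrime (n : ℕ) : ℕ := Nat.nth Nat.Prime (n - 1)

theorem sum_range_mul_of_coprime_of_periodic {a b : ℕ} (hab : a.Coprime b) (ha : 0 < a)
    (hb : 0 < b) {f g : ℕ → ℝ} (hf : Function.Periodic f a) (hg : Function.Periodic g b) :
    ∑ n ∈ Finset.range (a * b), f n * g n =
      (∑ n ∈ Finset.range a, f n) * ∑ n ∈ Finset.range b, g n := by
  rw [Finset.sum_mul_sum, ← Finset.sum_product']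
  refine Finset.sum_bij (fun n _ => (n % a, n % b)) ?_ ?_ ?_ ?_
  · intro n _
    simp [Nat.mod_lt _ ha, Nat.mod_lt _ hb]
  · intro m hm n hn hmn
    simp only [Prod.mk.injEq] at hmn
    have := (Nat.modEq_and_modEq_iff_modEq_mul hab).1 ⟨hmn.1, hmn.2⟩
    exact this.eq_of_lt_of_lt (Finset.mem_range.1 hm) (Finset.mem_range.1 hn)
  · rintro ⟨i, j⟩ hij
    simp only [Finset.mem_product, Finset.mem_range] at hij
    obtain ⟨k, hk⟩ := Nat.chineseRemainder hab i j
    have h1 : k % (a * b) % a = k % a := Nat.mod_mod_of_dvd _ (dvd_mul_right a b)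
    have h2 : k % (a * b) % b = k % b := Nat.mod_mod_of_dvd _ (dvd_mul_left b a)
    refine ⟨k % (a * b), Finset.mem_range.2 (Nat.mod_lt _ (Nat.mul_pos ha hb)), ?_⟩
    rw [h1, h2, hk.1, hk.2, Nat.mod_eq_of_lt hij.1, Nat.mod_eq_of_lt hij.2]
  · intro n _
    rw [hf.map_mod_nat, hg.map_mod_nat]

theorem periodic_prod_of_dvd {s : Finset ℕ} {f : ℕ → ℕ → ℝ}
    (hf : ∀ p ∈ s, Function.Periodic (f p) p) :
    Function.Periodic (fun n => ∏ p ∈ s, f p n) (∏ p ∈ s, p) := by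
  intro n
  refine Finset.prod_congr rfl fun p hp => ?_
  obtain ⟨k, hk⟩ := Finset.dvd_prod_of_mem (fun p : ℕ => p) hp
  rw [hk, mul_comm]
  exact (hf p hp).nat_mul k n

theorem sum_range_prod_of_periodic {s : Finset ℕ} (hs : ∀ p ∈ s, p.Prime) {f : ℕ → ℕ → ℝ}
    (hf : ∀ p ∈ s, Function.Periodic (f p) p) :
    ∑ n ∈ Finset.range (∏ p ∈ s, p), ∏ p ∈ s, f p n =
      ∏ p ∈ s, ∑ n ∈ Finset.range p, f p n := by
  induction s using Finset.induction_on with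
  | empty => simp
  | insert q s hq ih =>
    have hs' : ∀ p ∈ s, p.Prime := fun p hp => hs p (Finset.mem_insert_of_mem hp)
    have hf' : ∀ p ∈ s, Function.Periodic (f p) p := fun p hp => hf p (Finset.mem_insert_of_mem hp)
    have hqp : q.Prime := hs q (Finset.mem_insert_self q s)
    simp only [Finset.prod_insert hq]
    rw [sum_range_mul_of_coprime_of_periodic _ hqp.pos
      (Finset.prod_pos fun p hp => (hs' p hp).pos) (hf q (Finset.mem_insert_self q s))
      (periodic_prod_of_dvd hf'), ih hs' hf']
    refine Nat.Coprime.prod_right fun p hp => (Nat.coprime_primes hqp (hs' p hp)).2 ?_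
    rintro rfl
    exact hq hp

theorem sum_range_le_of_periodic {F : ℕ → ℝ} {M : ℕ} (hM : 0 < M) (hF : Function.Periodic F M)
    {B : ℝ} (hB : ∀ n, |F n| ≤ B) (h0 : 0 ≤ ∑ n ∈ Finset.range M, F n) (x : ℕ) :
    ∑ n ∈ Finset.range x, F n ≤ x / M * ∑ n ∈ Finset.range M, F n + M * B := by
  have hB0 : 0 ≤ B := (abs_nonneg _).trans (hB 0)
  induction x using Nat.strong_induction_on with
  | _ x ih =>
    rcases lt_or_ge x M with hx | hx
    · have h1 : ∑ n ∈ Finset.range x, F n ≤ M * B := calc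
        _ ≤ ∑ n ∈ Finset.range x, B := Finset.sum_le_sum fun n _ => (le_abs_self _).trans (hB n)
        _ = x * B := by simp
        _ ≤ M * B := by gcongr
      have h2 : 0 ≤ (x : ℝ) / M * ∑ n ∈ Finset.range M, F n := by positivity
      linarith
    · obtain ⟨y, rfl⟩ := Nat.exists_eq_add_of_le hx
      have h1 := ih y (by lia)
      have h2 : ∑ n ∈ Finset.range y, F (M + n) = ∑ n ∈ Finset.range y, F n :=
        Finset.sum_congr rfl fun n _ => by rw [add_comm, hF n]
      have hM' : (M : ℝ) ≠ 0 := by positivity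
      rw [Finset.sum_range_add, h2]
      push_cast
      rw [add_div, div_self hM']
      linarith

theorem card_mul_sq_le_of_orthogonal {P : Finset ℕ} (hP : ∀ p ∈ P, p.Prime)
    {𝓕 : Finset (Finset ℕ)} (h𝓕 : ∀ s ∈ 𝓕, s ⊆ P) {z : ℕ} (hz : ∀ s ∈ 𝓕, ∏ p ∈ s, p ≤ z)
    {ψ : ℕ → ℕ → ℝ} {g : ℕ → ℝ} (hψ : ∀ p ∈ P, Function.Periodic (ψ p) p)
    (hψ0 : ∀ p ∈ P, ∑ n ∈ Finset.range p, ψ p n = 0)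
    (hψ2 : ∀ p ∈ P, ∑ n ∈ Finset.range p, ψ p n ^ 2 = p * g p) (hg : ∀ p ∈ P, 0 ≤ g p)
    (hψp : ∀ p ∈ P, ∀ n, |ψ p n| ≤ p) {x : ℕ} {A : Finset ℕ} (hA : A ⊆ Finset.range x)
    (hAψ : ∀ n ∈ A, ∀ p ∈ P, ψ p n = g p) :
    (A.card : ℝ) * (∑ s ∈ 𝓕, ∏ p ∈ s, g p) ^ 2 ≤
      x * ∑ s ∈ 𝓕, ∏ p ∈ s, g p + 𝓕.card ^ 2 * z ^ 4 := by
  have hpair : ∀ s ∈ 𝓕, ∀ t ∈ 𝓕,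
      ∑ n ∈ Finset.range x, (∏ p ∈ s, ψ p n) * ∏ p ∈ t, ψ p n ≤
        (if s = t then x * ∏ p ∈ s, g p else 0) + z ^ 4 := by
    intro s hs t ht
    have hsP := h𝓕 s hs
    have htP := h𝓕 t ht
    set f : ℕ → ℕ → ℝ := fun p n => (if p ∈ s then ψ p n else 1) * (if p ∈ t then ψ p n else 1)
      with hf
    have huP : s ∪ t ⊆ P := Finset.union_subset hsP htP
    have hfper : ∀ p ∈ s ∪ t, Function.Periodic (f p) p := by
      intro p hp n
      simp only [hf, hψ p (huP hp) n]
    have hprod : ∀ n, (∏ p ∈ s, ψ p n) * ∏ p ∈ t, ψ p n = ∏ p ∈ s ∪ t, f p n := by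
      intro n
      simp only [hf]
      rw [Finset.prod_mul_distrib, Finset.prod_ite_mem, Finset.prod_ite_mem,
        Finset.inter_eq_right.2 Finset.subset_union_left,
        Finset.inter_eq_right.2 Finset.subset_union_right]
    have hbound : ∀ u ∈ 𝓕, ∀ n, |∏ p ∈ u, ψ p n| ≤ z := by
      intro u hu n
      rw [Finset.abs_prod]
      calc ∏ p ∈ u, |ψ p n| ≤ ∏ p ∈ u, (p : ℝ) :=
            Finset.prod_le_prod (fun _ _ => abs_nonneg _) fun p hp => hψp p (h𝓕 u hu hp) n
        _ ≤ z := by rw [← Nat.cast_prod]; exact Nat.cast_le.2 (hz u hu)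
    have hM : 0 < ∏ p ∈ s ∪ t, p := Finset.prod_pos fun p hp => (hP p (huP hp)).pos
    have hMz : ((∏ p ∈ s ∪ t, p : ℕ) : ℝ) ≤ z ^ 2 := by
      have h1 : ∏ p ∈ s ∪ t, p ≤ (∏ p ∈ s, p) * ∏ p ∈ t, p := by
        rw [← Finset.prod_union_inter]
        exact Nat.le_mul_of_pos_right _ (Finset.prod_pos fun p hp =>
          (hP p (hsP (Finset.mem_of_mem_inter_left hp))).pos)
      have h2 := h1.trans (Nat.mul_le_mul (hz s hs) (hz t ht))
      rw [← pow_two] at h2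
      exact_mod_cast h2
    have hval : ∑ n ∈ Finset.range (∏ p ∈ s ∪ t, p), ∏ p ∈ s ∪ t, f p n =
        if s = t then ((∏ p ∈ s ∪ t, p : ℕ) : ℝ) * ∏ p ∈ s, g p else 0 := by
      rw [sum_range_prod_of_periodic (fun p hp => hP p (huP hp)) hfper]
      split_ifs with hst
      · subst hst
        rw [Finset.union_self, Nat.cast_prod, ← Finset.prod_mul_distrib]
        refine Finset.prod_congr rfl fun p hp => ?_
        rw [← hψ2 p (hsP hp)]
        simp [hf, hp, pow_two]
      · obtain ⟨p, hp⟩ : ∃ p, (p ∈ s ∧ p ∉ t) ∨ (p ∈ t ∧ p ∉ s) := by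
          by_contra! hcon
          exact hst (Finset.ext fun p => ⟨(hcon p).1, (hcon p).2⟩)
        have hpu : p ∈ s ∪ t := by simp only [Finset.mem_union]; tauto
        refine Finset.prod_eq_zero hpu ?_
        rw [← hψ0 p (huP hpu)]
        rcases hp with hp | hp <;> simp [hf, hp.1, hp.2]
    have hgs : 0 ≤ ∏ p ∈ s, g p := Finset.prod_nonneg fun p hp => hg p (hsP hp)
    simp only [hprod]
    have hmain := sum_range_le_of_periodic hM (periodic_prod_of_dvd hfper) (B := z ^ 2)
      (fun n => by
        rw [← hprod, abs_mul, pow_two]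
        exact mul_le_mul (hbound s hs n) (hbound t ht n) (abs_nonneg _) (Nat.cast_nonneg z))
      (by rw [hval]; split_ifs <;> positivity) x
    refine hmain.trans ?_
    rw [hval]
    refine add_le_add (le_of_eq ?_) ?_
    · have : ((∏ p ∈ s ∪ t, p : ℕ) : ℝ) ≠ 0 := by positivity
      split_ifs
      · rw [← mul_assoc, div_mul_cancel₀ _ this]
      · simp
    · calc ((∏ p ∈ s ∪ t, p : ℕ) : ℝ) * (z : ℝ) ^ 2 ≤ (z : ℝ) ^ 2 * (z : ℝ) ^ 2 := by gcongr
        _ = (z : ℝ) ^ 4 := by ring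
  calc (A.card : ℝ) * (∑ s ∈ 𝓕, ∏ p ∈ s, g p) ^ 2
      = ∑ n ∈ A, (∑ s ∈ 𝓕, ∏ p ∈ s, ψ p n) ^ 2 := by
        rw [← nsmul_eq_mul, ← Finset.sum_const]
        refine Finset.sum_congr rfl fun n hn => ?_
        congr 1
        exact Finset.sum_congr rfl fun s hs => Finset.prod_congr rfl fun p hp =>
          (hAψ n hn p (h𝓕 s hs hp)).symm
    _ ≤ ∑ n ∈ Finset.range x, (∑ s ∈ 𝓕, ∏ p ∈ s, ψ p n) ^ 2 :=
        Finset.sum_le_sum_of_subset_of_nonneg hA fun _ _ _ => sq_nonneg _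
    _ = ∑ s ∈ 𝓕, ∑ t ∈ 𝓕, ∑ n ∈ Finset.range x, (∏ p ∈ s, ψ p n) * ∏ p ∈ t, ψ p n := by
        simp only [pow_two, Finset.sum_mul_sum]
        rw [Finset.sum_comm]
        exact Finset.sum_congr rfl fun s _ => Finset.sum_comm
    _ ≤ ∑ s ∈ 𝓕, ∑ t ∈ 𝓕, ((if s = t then x * ∏ p ∈ s, g p else 0) + z ^ 4) :=
        Finset.sum_le_sum fun s hs => Finset.sum_le_sum fun t ht => hpair s hs t ht
    _ = x * ∑ s ∈ 𝓕, ∏ p ∈ s, g p + 𝓕.card ^ 2 * z ^ 4 := by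
        simp only [Finset.sum_add_distrib, Finset.sum_const, nsmul_eq_mul, Finset.sum_ite_eq]
        rw [Finset.sum_congr rfl fun s hs => if_pos hs, ← Finset.mul_sum]
        ring

theorem sum_le_sum_of_injOn_of_nonneg {α β : Type*} {s : Finset α} {t : Finset β} {f : α → ℝ}
    {g : β → ℝ} (e : α → β) (he : ∀ a ∈ s, e a ∈ t) (hinj : Set.InjOn e s)
    (hg : ∀ b ∈ t, 0 ≤ g b) (hfg : ∀ a ∈ s, f a ≤ g (e a)) : ∑ a ∈ s, f a ≤ ∑ b ∈ t, g b := by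
  classical
  calc ∑ a ∈ s, f a ≤ ∑ a ∈ s, g (e a) := Finset.sum_le_sum hfg
    _ = ∑ b ∈ s.image e, g b := (Finset.sum_image hinj).symm
    _ ≤ ∑ b ∈ t, g b := Finset.sum_le_sum_of_subset_of_nonneg
        (Finset.image_subset_iff.2 he) fun b hb _ => hg b hb

/-- The sets of primes whose product is at most `z`; they correspond to the squarefree positive
integers up to `z`. -/
def primeSets (z : ℕ) : Finset (Finset ℕ) :=
  (Nat.primesLE z).powerset.filter fun s => ∏ p ∈ s, p ≤ z

theorem mem_primeSets {z : ℕ} {s : Finset ℕ} :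
    s ∈ primeSets z ↔ (∀ p ∈ s, p.Prime) ∧ ∏ p ∈ s, p ≤ z := by
  simp only [primeSets, Finset.mem_filter, Finset.mem_powerset, Finset.subset_iff,
    Nat.mem_primesLE]
  refine ⟨fun h => ⟨fun p hp => (h.1 hp).2, h.2⟩, fun h => ⟨fun p hp => ⟨?_, h.1 p hp⟩, h.2⟩⟩
  exact (Finset.single_le_prod' (f := fun p : ℕ => p) (fun q hq => (h.1 q hq).one_le) hp).trans h.2

theorem subset_primesLE_of_mem_primeSets {z : ℕ} {s : Finset ℕ} (hs : s ∈ primeSets z) :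
    s ⊆ Nat.primesLE z :=
  Finset.mem_powerset.1 (Finset.mem_filter.1 hs).1

theorem mem_primeSets_of_subset {z : ℕ} {s t : Finset ℕ} (hs : s ∈ primeSets z) (hts : t ⊆ s) :
    t ∈ primeSets z := by
  rw [mem_primeSets] at hs ⊢
  refine ⟨fun p hp => hs.1 p (hts hp), le_trans ?_ hs.2⟩
  exact Finset.prod_le_prod_of_subset_of_one_le' hts fun p hp _ => (hs.1 p hp).one_le

theorem card_primeSets_le (z : ℕ) : (primeSets z).card ≤ z := by
  calc (primeSets z).card ≤ (Finset.Icc 1 z).card := by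
        refine Finset.card_le_card_of_injOn (fun s => ∏ p ∈ s, p) ?_ ?_
        · intro s hs
          rw [Finset.mem_coe, mem_primeSets] at hs
          exact Finset.mem_coe.2 (Finset.mem_Icc.2
            ⟨Finset.prod_pos fun p hp => (hs.1 p hp).pos, hs.2⟩)
        · intro s hs t ht hst
          rw [Finset.mem_coe, mem_primeSets] at hs ht
          rw [← Nat.primeFactors_prod hs.1, ← Nat.primeFactors_prod ht.1]
          exact congrArg Nat.primeFactors hst
    _ = z := by simp

theorem sum_primeSets_prod_add_le {z : ℕ} {a b : ℕ → ℝ} (ha : ∀ p, p.Prime → 0 ≤ a p)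
    (hb : ∀ p, p.Prime → 0 ≤ b p) :
    ∑ s ∈ primeSets z, ∏ p ∈ s, (a p + b p) ≤
      (∏ p ∈ Nat.primesLE z, (1 + a p)) * ∑ s ∈ primeSets z, ∏ p ∈ s, b p := by
  rw [Finset.prod_one_add, Finset.sum_mul_sum, ← Finset.sum_product']
  simp only [Finset.prod_add]
  rw [Finset.sum_sigma']
  refine sum_le_sum_of_injOn_of_nonneg (fun x => (x.2, x.1 \ x.2)) ?_ ?_ ?_ fun _ _ => le_rfl
  · rintro ⟨s, t⟩ h
    simp only [Finset.mem_sigma, Finset.mem_powerset] at h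
    simp only [Finset.mem_product, Finset.mem_powerset]
    exact ⟨h.2.trans (subset_primesLE_of_mem_primeSets h.1),
      mem_primeSets_of_subset h.1 Finset.sdiff_subset⟩
  · rintro ⟨s, t⟩ h ⟨s', t'⟩ h' heq
    simp only [Finset.coe_sigma, Set.mem_sigma_iff, Finset.mem_coe, Finset.mem_powerset] at h h'
    simp only [Prod.mk.injEq] at heq
    obtain ⟨rfl, h2⟩ := heq
    have : s = s' := by
      rw [← Finset.union_sdiff_of_subset h.2, h2, Finset.union_sdiff_of_subset h'.2]
    rw [this]
  · rintro ⟨t, u⟩ h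
    simp only [Finset.mem_product, Finset.mem_powerset] at h
    exact mul_nonneg (Finset.prod_nonneg fun p hp => ha p (Nat.prime_of_mem_primesLE (h.1 hp)))
      (Finset.prod_nonneg fun p hp => hb p ((mem_primeSets.1 h.2).1 p hp))

theorem sum_primeSets_inv_sq_le (y : ℕ) :
    (∑ s ∈ primeSets y, ∏ p ∈ s, (1 / (p : ℝ))) ^ 2 ≤
      ∑ s ∈ primeSets (y ^ 2), ∏ p ∈ s, (2 / (p : ℝ) + 1 / (p : ℝ) ^ 2) := by
  have hexp : ∀ s : Finset ℕ, ∏ p ∈ s, (2 / (p : ℝ) + 1 / (p : ℝ) ^ 2) =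
      ∑ u ∈ s.powerset, ∑ w ∈ u.powerset,
        (∏ p ∈ u, (1 / (p : ℝ))) * ((∏ p ∈ s \ u, (1 / (p : ℝ))) * ∏ p ∈ w, (1 / (p : ℝ))) := by
    intro s
    have h1 : ∀ p : ℕ, 2 / (p : ℝ) + 1 / (p : ℝ) ^ 2 =
        1 / (p : ℝ) * (1 + 1 / (p : ℝ)) + 1 / (p : ℝ) := by
      intro p
      rw [pow_two, ← one_div_mul_one_div]
      ring
    simp only [h1]
    rw [Finset.prod_add]
    refine Finset.sum_congr rfl fun u _ => ?_
    rw [Finset.prod_mul_distrib, Finset.prod_one_add, Finset.mul_sum, Finset.sum_mul]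
    exact Finset.sum_congr rfl fun w _ => by ring
  simp only [hexp]
  rw [pow_two, Finset.sum_mul_sum, ← Finset.sum_product']
  simp only [Finset.sum_sigma']
  refine sum_le_sum_of_injOn_of_nonneg (fun x => ⟨x.1 ∪ x.2, ⟨x.1, x.1 ∩ x.2⟩⟩) ?_ ?_ ?_ ?_
  · rintro ⟨u, v⟩ h
    simp only [Finset.mem_product, mem_primeSets] at h
    obtain ⟨⟨hu, hu'⟩, hv, hv'⟩ := h
    simp only [Finset.mem_sigma, Finset.mem_powerset, Finset.subset_union_left,
      Finset.inter_subset_left, and_true, mem_primeSets]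
    refine ⟨fun p hp => (Finset.mem_union.1 hp).elim (hu p) (hv p), ?_⟩
    calc ∏ p ∈ u ∪ v, p ≤ (∏ p ∈ u ∪ v, p) * ∏ p ∈ u ∩ v, p :=
          Nat.le_mul_of_pos_right _ (Finset.prod_pos fun p hp =>
            (hu p (Finset.mem_of_mem_inter_left hp)).pos)
      _ = (∏ p ∈ u, p) * ∏ p ∈ v, p := Finset.prod_union_inter
      _ ≤ y ^ 2 := by rw [pow_two]; exact Nat.mul_le_mul hu' hv'
  · rintro ⟨u, v⟩ _ ⟨u', v'⟩ _ heq
    simp only [Sigma.mk.injEq, heq_eq_eq] at heq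
    obtain ⟨h1, rfl, h3⟩ := heq
    rw [Finset.union_comm u, Finset.union_comm u] at h1
    rw [Finset.inter_comm u, Finset.inter_comm u] at h3
    rw [eq_of_inf_eq_sup_eq h3 h1]
  · intro _ _
    positivity
  · rintro ⟨u, v⟩ _
    refine le_of_eq ?_
    dsimp only
    congr 1
    rw [Finset.union_sdiff_left, Finset.inter_comm, ← Finset.prod_union
      (Finset.disjoint_sdiff_inter v u), Finset.sdiff_union_inter]

theorem sum_Icc_inv_sq_le_two (n : ℕ) : ∑ b ∈ Finset.Icc 1 n, 1 / (b : ℝ) ^ 2 ≤ 2 := by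
  rcases Nat.eq_zero_or_pos n with rfl | hn
  · simp
  have : ∑ b ∈ Finset.Icc 1 n, 1 / (b : ℝ) ^ 2 ≤ 2 - 1 / (n : ℝ) := by
    induction n, hn using Nat.le_induction with
    | base => norm_num
    | succ n hn ih =>
      rw [Finset.sum_Icc_succ_top (by lia)]
      have hn' : (0 : ℝ) < n := by exact_mod_cast hn
      have : 1 / ((n + 1 : ℕ) : ℝ) ^ 2 ≤ 1 / n - 1 / ((n + 1 : ℕ) : ℝ) := by
        push_cast
        rw [div_sub_div _ _ hn'.ne' (by positivity), div_le_div_iff₀ (by positivity) (by positivity)]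
        nlinarith
      linarith
  have h2 : 0 ≤ 1 / (n : ℝ) := by positivity
  linarith

theorem log_le_two_mul_sum_primeSets (y : ℕ) :
    Real.log y ≤ 2 * ∑ s ∈ primeSets y, ∏ p ∈ s, (1 / (p : ℝ)) := by
  have hlog : Real.log y ≤ ∑ n ∈ Finset.Icc 1 y, 1 / (n : ℝ) := by
    rcases Nat.eq_zero_or_pos y with rfl | hy
    · simp
    have h1 : Real.log y ≤ Real.log ((y + 1 : ℕ) : ℝ) :=
      Real.log_le_log (by exact_mod_cast hy) (by push_cast; linarith)
    have h2 := log_add_one_le_harmonic y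
    rw [harmonic_eq_sum_Icc] at h2
    push_cast at h1 h2
    simpa only [one_div] using h1.trans h2
  refine hlog.trans (le_trans ?_ (mul_le_mul_of_nonneg_right (sum_Icc_inv_sq_le_two y)
    (Finset.sum_nonneg fun _ _ => by positivity)))
  rw [Finset.sum_mul_sum, ← Finset.sum_product']
  have hdecomp : ∀ n ∈ Finset.Icc 1 y, ∃ x : ℕ × Finset ℕ,
      x ∈ Finset.Icc 1 y ×ˢ primeSets y ∧ x.1 ^ 2 * ∏ p ∈ x.2, p = n := by
    intro n hn
    rw [Finset.mem_Icc] at hn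
    obtain ⟨a, b, hab, ha⟩ := Nat.sq_mul_squarefree n
    have hb0 : 0 < b := Nat.pos_of_ne_zero (by rintro rfl; simp at hab; lia)
    have ha0 : 0 < a := Nat.pos_of_ne_zero ha.ne_zero
    have hprod : ∏ p ∈ a.primeFactors, p = a := Nat.prod_primeFactors_of_squarefree ha
    refine ⟨(b, a.primeFactors), ?_, by simpa only [hprod] using hab⟩
    simp only [Finset.mem_product, Finset.mem_Icc, mem_primeSets, hprod]
    refine ⟨⟨hb0, ?_⟩, fun p hp => Nat.prime_of_mem_primeFactors hp, ?_⟩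
    · nlinarith
    · nlinarith [pow_pos hb0 2]
  choose! e he he' using hdecomp
  refine sum_le_sum_of_injOn_of_nonneg e he ?_ (fun _ _ => by positivity) ?_
  · intro m hm n hn hmn
    rw [← he' m hm, ← he' n hn, hmn]
  · intro n hn
    rw [Finset.prod_div_distrib, Finset.prod_const_one, one_div_mul_one_div, ← Nat.cast_prod]
    exact_mod_cast le_of_eq (congrArg (fun m : ℕ => 1 / (m : ℝ)) (he' n hn).symm)

theorem card_filter_dvd_or_dvd_add {p h : ℕ} (hp : 0 < p) :
    ((Finset.range p).filter fun n => p ∣ n ∨ p ∣ n + h).card = if p ∣ h then 1 else 2 := by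
  split_ifs with hph
  · rw [Finset.card_eq_one]
    refine ⟨0, Finset.ext fun n => ?_⟩
    simp only [Finset.mem_filter, Finset.mem_range, Finset.mem_singleton, Nat.dvd_add_left hph,
      or_self]
    exact ⟨fun hn => Nat.eq_zero_of_dvd_of_lt hn.2 hn.1, by rintro rfl; simpa using hp⟩
  · have hr : 0 < h % p := Nat.pos_of_ne_zero fun h0 => hph (Nat.dvd_of_mod_eq_zero h0)
    have hrp : h % p < p := Nat.mod_lt _ hp
    have hdvd : ∀ n, p ∣ n + h ↔ p ∣ n + h % p := by
      intro n
      rw [Nat.dvd_iff_mod_eq_zero, Nat.dvd_iff_mod_eq_zero, Nat.add_mod_mod]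
    rw [Finset.card_eq_two]
    refine ⟨0, p - h % p, by lia, Finset.ext fun n => ?_⟩
    simp only [Finset.mem_filter, Finset.mem_range, Finset.mem_insert, Finset.mem_singleton, hdvd]
    constructor
    · rintro ⟨hn, hn' | ⟨k, hk⟩⟩
      · exact Or.inl (Nat.eq_zero_of_dvd_of_lt hn' hn)
      · have hk1 : k = 1 := by
          have h1 : 0 < k := Nat.pos_of_ne_zero (by rintro rfl; lia)
          have h2 : k < 2 := by
            by_contra hcon
            have : p * 2 ≤ p * k := Nat.mul_le_mul_left p (by lia)
            lia
          lia
        subst hk1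
        lia
    · rintro (rfl | rfl)
      · exact ⟨hp, Or.inl (dvd_zero p)⟩
      · exact ⟨by lia, Or.inr (by rw [Nat.sub_add_cancel hrp.le])⟩

/-- The local density `ρ / (p - ρ)`, where `ρ` is the number of residue classes modulo `p` that are
excluded when both `n` and `n + h` are prime to `p`. -/
noncomputable def pairDensity (h p : ℕ) : ℝ :=
  if p ∣ h then 1 / ((p : ℝ) - 1) else 2 / ((p : ℝ) - 2)

section pairDensity

variable {h p : ℕ}

theorem three_le_of_not_dvd (hh : 2 ∣ h) (hp : p.Prime) (hph : ¬ p ∣ h) : 3 ≤ p := by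
  have := hp.two_le
  rcases this.lt_or_eq with h2 | rfl
  · exact h2
  · exact absurd hh hph

theorem pairDensity_nonneg (hh : 2 ∣ h) (hp : p.Prime) : 0 ≤ pairDensity h p := by
  unfold pairDensity
  split_ifs with hph
  · have : (2 : ℝ) ≤ p := by exact_mod_cast hp.two_le
    exact div_nonneg zero_le_one (by linarith)
  · have : (3 : ℝ) ≤ p := by exact_mod_cast three_le_of_not_dvd hh hp hph
    exact div_nonneg zero_le_two (by linarith)

theorem pairDensity_le (hh : 2 ∣ h) (hp : p.Prime) : pairDensity h p ≤ p := by
  unfold pairDensity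
  split_ifs with hph
  · have : (2 : ℝ) ≤ p := by exact_mod_cast hp.two_le
    rw [div_le_iff₀ (by linarith)]
    nlinarith
  · have : (3 : ℝ) ≤ p := by exact_mod_cast three_le_of_not_dvd hh hp hph
    rw [div_le_iff₀ (by linarith)]
    nlinarith

theorem two_div_add_le_pairDensity (hh : 2 ∣ h) (hp : p.Prime) :
    2 / (p : ℝ) + 1 / (p : ℝ) ^ 2 ≤ (if p ∣ h then 1 / (p : ℝ) else 0) + pairDensity h p := by
  unfold pairDensity
  have h2 : (2 : ℝ) ≤ p := by exact_mod_cast hp.two_le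
  have h0 : (0 : ℝ) < p := by linarith
  split_ifs with hph
  · have : 1 / (p : ℝ) + 1 / (p : ℝ) ^ 2 ≤ 1 / ((p : ℝ) - 1) := by
      rw [div_add_div _ _ (by positivity) (by positivity),
        div_le_div_iff₀ (by positivity) (by linarith)]
      nlinarith
    have h3 : 2 / (p : ℝ) = 1 / p + 1 / p := by ring
    linarith
  · have h3 : (3 : ℝ) ≤ p := by exact_mod_cast three_le_of_not_dvd hh hp hph
    rw [zero_add, div_add_div _ _ (by positivity) (by positivity),
      div_le_div_iff₀ (by positivity) (by linarith)]
    nlinarith [mul_pos h0 h0]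

theorem sum_range_pairDensity (hh : 2 ∣ h) (hp : p.Prime) :
    ∑ n ∈ Finset.range p, (if p ∣ n ∨ p ∣ n + h then -1 else pairDensity h p) = 0 ∧
      ∑ n ∈ Finset.range p, (if p ∣ n ∨ p ∣ n + h then -1 else pairDensity h p) ^ 2 =
        p * pairDensity h p := by
  have hcard := card_filter_dvd_or_dvd_add (h := h) hp.pos
  have hcard' := Finset.card_filter_add_card_filter_not (s := Finset.range p)
    (fun n => p ∣ n ∨ p ∣ n + h)
  rw [hcard, Finset.card_range] at hcard'
  have hcardR : (((Finset.range p).filter fun n => ¬ (p ∣ n ∨ p ∣ n + h)).card : ℝ) =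
      p - (if p ∣ h then 1 else 2) := by
    rw [eq_sub_iff_add_eq']
    exact_mod_cast hcard'
  simp only [ite_pow, Finset.sum_ite, Finset.sum_const, nsmul_eq_mul, hcardR, hcard]
  unfold pairDensity
  split_ifs with hph
  · have : (2 : ℝ) ≤ p := by exact_mod_cast hp.two_le
    have h1 : (p : ℝ) - 1 ≠ 0 := by linarith
    constructor <;> push_cast <;> field_simp <;> ring
  · have : (3 : ℝ) ≤ p := by exact_mod_cast three_le_of_not_dvd hh hp hph
    have h1 : (p : ℝ) - 2 ≠ 0 := by linarith
    constructor <;> push_cast <;> field_simp <;> ring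

end pairDensity

theorem card_coprime_pair_mul_sq_le {h : ℕ} (hh : 2 ∣ h) (x z : ℕ) :
    (((Finset.range x).filter fun n => ∀ p ∈ Nat.primesLE z, ¬ (p ∣ n ∨ p ∣ n + h)).card : ℝ) *
        (∑ s ∈ primeSets z, ∏ p ∈ s, pairDensity h p) ^ 2 ≤
      x * ∑ s ∈ primeSets z, ∏ p ∈ s, pairDensity h p + z ^ 6 := by
  have key := card_mul_sq_le_of_orthogonal (P := Nat.primesLE z) (𝓕 := primeSets z) (z := z)
    (ψ := fun p n => if p ∣ n ∨ p ∣ n + h then -1 else pairDensity h p) (g := pairDensity h)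
    (x := x) (A := (Finset.range x).filter fun n => ∀ p ∈ Nat.primesLE z, ¬ (p ∣ n ∨ p ∣ n + h))
    (fun p hp => Nat.prime_of_mem_primesLE hp) (fun s hs => subset_primesLE_of_mem_primeSets hs)
    (fun s hs => (mem_primeSets.1 hs).2)
    (fun p _ n => by
      have : n + p + h = n + h + p := by ring
      simp only [this, Nat.dvd_add_self_right])
    (fun p hp => (sum_range_pairDensity hh (Nat.prime_of_mem_primesLE hp)).1)
    (fun p hp => (sum_range_pairDensity hh (Nat.prime_of_mem_primesLE hp)).2)
    (fun p hp => pairDensity_nonneg hh (Nat.prime_of_mem_primesLE hp))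
    (fun p hp n => by
      have hp' := Nat.prime_of_mem_primesLE hp
      split_ifs
      · rw [abs_neg, abs_one]
        exact_mod_cast hp'.one_le
      · rw [abs_of_nonneg (pairDensity_nonneg hh hp')]
        exact pairDensity_le hh hp')
    (Finset.filter_subset _ _)
    (fun n hn p hp => if_neg ((Finset.mem_filter.1 hn).2 p hp))
  refine key.trans ?_
  have hcard : ((primeSets z).card : ℝ) ≤ z := by exact_mod_cast card_primeSets_le z
  have : ((primeSets z).card : ℝ) ^ 2 * (z : ℝ) ^ 4 ≤ (z : ℝ) ^ 2 * (z : ℝ) ^ 4 := by gcongr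
  have h6 : (z : ℝ) ^ 2 * (z : ℝ) ^ 4 = (z : ℝ) ^ 6 := by ring
  linarith

theorem log_sq_le_mul_sum_primeSets {h : ℕ} (hh : 2 ∣ h) (h0 : h ≠ 0) (y : ℕ) :
    Real.log y ^ 2 ≤ 4 * (∑ d ∈ h.divisors, 1 / (d : ℝ)) *
      ∑ s ∈ primeSets (y ^ 2), ∏ p ∈ s, pairDensity h p := by
  have hdiv : ∏ p ∈ Nat.primesLE (y ^ 2), (1 + if p ∣ h then 1 / (p : ℝ) else 0) ≤
      ∑ d ∈ h.divisors, 1 / (d : ℝ) := by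
    have h1 : ∀ p : ℕ, (1 + if p ∣ h then 1 / (p : ℝ) else 0) =
        if p ∣ h then 1 + 1 / (p : ℝ) else 1 := fun p => by split_ifs <;> simp
    simp only [h1]
    rw [← Finset.prod_filter, Finset.prod_one_add]
    have hprime : ∀ s ∈ ((Nat.primesLE (y ^ 2)).filter (· ∣ h)).powerset,
        ∀ p ∈ s, p.Prime ∧ p ∣ h := fun s hs p hp =>
      have := Finset.mem_filter.1 (Finset.mem_powerset.1 hs hp)
      ⟨Nat.prime_of_mem_primesLE this.1, this.2⟩
    refine sum_le_sum_of_injOn_of_nonneg (fun s => ∏ p ∈ s, p) ?_ ?_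
      (fun _ _ => by positivity) ?_
    · intro s hs
      refine Nat.mem_divisors.2 ⟨?_, h0⟩
      exact Finset.prod_primes_dvd h (fun p hp => (hprime s hs p hp).1.prime)
        fun p hp => (hprime s hs p hp).2
    · intro s hs t ht hst
      rw [← Nat.primeFactors_prod fun p hp => (hprime s hs p hp).1,
        ← Nat.primeFactors_prod fun p hp => (hprime t ht p hp).1]
      exact congrArg Nat.primeFactors hst
    · intro s _
      rw [Finset.prod_div_distrib, Finset.prod_const_one, Nat.cast_prod]
  have hlog0 : 0 ≤ Real.log y := Real.log_natCast_nonneg y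
  have hG : 0 ≤ ∑ s ∈ primeSets (y ^ 2), ∏ p ∈ s, pairDensity h p :=
    Finset.sum_nonneg fun s hs => Finset.prod_nonneg fun p hp =>
      pairDensity_nonneg hh ((mem_primeSets.1 hs).1 p hp)
  calc Real.log y ^ 2 ≤ (2 * ∑ s ∈ primeSets y, ∏ p ∈ s, (1 / (p : ℝ))) ^ 2 :=
        pow_le_pow_left₀ hlog0 (log_le_two_mul_sum_primeSets y) 2
    _ = 4 * (∑ s ∈ primeSets y, ∏ p ∈ s, (1 / (p : ℝ))) ^ 2 := by ring
    _ ≤ 4 * ∑ s ∈ primeSets (y ^ 2), ∏ p ∈ s, (2 / (p : ℝ) + 1 / (p : ℝ) ^ 2) := by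
        gcongr
        exact sum_primeSets_inv_sq_le y
    _ ≤ 4 * ∑ s ∈ primeSets (y ^ 2), ∏ p ∈ s,
          ((if p ∣ h then 1 / (p : ℝ) else 0) + pairDensity h p) := by
        refine mul_le_mul_of_nonneg_left (Finset.sum_le_sum fun s hs => ?_) (by norm_num)
        refine Finset.prod_le_prod (fun _ _ => by positivity) fun p hp => ?_
        exact two_div_add_le_pairDensity hh ((mem_primeSets.1 hs).1 p hp)
    _ ≤ 4 * ((∏ p ∈ Nat.primesLE (y ^ 2), (1 + if p ∣ h then 1 / (p : ℝ) else 0)) *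
          ∑ s ∈ primeSets (y ^ 2), ∏ p ∈ s, pairDensity h p) := by
        gcongr
        exact sum_primeSets_prod_add_le (fun p _ => by positivity)
          fun p hp => pairDensity_nonneg hh hp
    _ ≤ 4 * ((∑ d ∈ h.divisors, 1 / (d : ℝ)) *
          ∑ s ∈ primeSets (y ^ 2), ∏ p ∈ s, pairDensity h p) := by gcongr
    _ = _ := by ring

theorem card_prime_pair_le_of_even {h : ℕ} (hh : 2 ∣ h) (h0 : h ≠ 0) (x : ℕ) {y : ℕ}
    (hy : 2 ≤ y) :
    (((Finset.range x).filter fun n => n.Prime ∧ (n + h).Prime).card : ℝ) ≤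
      4 * x * (∑ d ∈ h.divisors, 1 / (d : ℝ)) / Real.log y ^ 2 + 3 * (y : ℝ) ^ 12 := by
  set z := y ^ 2 with hz
  set G := ∑ s ∈ primeSets z, ∏ p ∈ s, pairDensity h p with hG
  set B := ∑ d ∈ h.divisors, 1 / (d : ℝ) with hB
  set S := (Finset.range x).filter fun n => ∀ p ∈ Nat.primesLE z, ¬ (p ∣ n ∨ p ∣ n + h) with hS
  have hsub : ((Finset.range x).filter fun n => n.Prime ∧ (n + h).Prime) ⊆
      S ∪ Finset.range (z + 1) := by
    intro n hn
    simp only [Finset.mem_filter, Finset.mem_range] at hn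
    obtain ⟨hnx, hnp, hnhp⟩ := hn
    simp only [hS, Finset.mem_union, Finset.mem_filter, Finset.mem_range, Nat.mem_primesLE]
    rcases lt_or_ge n (z + 1) with hnz | hnz
    · exact Or.inr hnz
    · refine Or.inl ⟨hnx, ?_⟩
      rintro p ⟨hpz, hp⟩ (hpn | hpn)
      · have := (Nat.prime_dvd_prime_iff_eq hp hnp).1 hpn
        lia
      · have := (Nat.prime_dvd_prime_iff_eq hp hnhp).1 hpn
        lia
  have hcard : (((Finset.range x).filter fun n => n.Prime ∧ (n + h).Prime).card : ℝ) ≤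
      S.card + (z + 1) := by
    have := (Finset.card_le_card hsub).trans (Finset.card_union_le _ _)
    rw [Finset.card_range] at this
    exact_mod_cast this
  have hz1 : 1 ≤ z := Nat.one_le_pow _ _ (by lia)
  have hG1 : 1 ≤ G := by
    have hmem : ∅ ∈ primeSets z := mem_primeSets.2 ⟨by simp, by simpa using hz1⟩
    have := Finset.single_le_sum (f := fun s => ∏ p ∈ s, pairDensity h p) (fun s hs =>
      Finset.prod_nonneg fun p hp => pairDensity_nonneg hh ((mem_primeSets.1 hs).1 p hp)) hmem
    simpa using this
  have hL : 0 < Real.log y := Real.log_pos (by exact_mod_cast hy)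
  have hLG : Real.log y ^ 2 ≤ 4 * B * G := log_sq_le_mul_sum_primeSets hh h0 y
  have hsieve : (S.card : ℝ) * G ^ 2 ≤ x * G + z ^ 6 := card_coprime_pair_mul_sq_le hh x z
  have hS1 : (S.card : ℝ) ≤ x / G + z ^ 6 := by
    have h1 : (S.card : ℝ) ≤ (x * G + z ^ 6) / G ^ 2 := by
      rwa [le_div_iff₀ (by positivity)]
    refine h1.trans ?_
    rw [add_div]
    refine add_le_add (le_of_eq (by field_simp)) ?_
    exact div_le_self (by positivity) (one_le_pow₀ hG1)
  have hxG : (x : ℝ) / G ≤ 4 * x * B / Real.log y ^ 2 := by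
    rw [div_le_div_iff₀ (by positivity) (by positivity)]
    calc (x : ℝ) * Real.log y ^ 2 ≤ x * (4 * B * G) := by gcongr
      _ = 4 * x * B * G := by ring
  have hy1 : (1 : ℝ) ≤ y := by exact_mod_cast (by lia : 1 ≤ y)
  have h12 : (z : ℝ) ^ 6 = (y : ℝ) ^ 12 := by rw [hz]; push_cast; ring
  have hz12 : (z : ℝ) ≤ (y : ℝ) ^ 12 := by
    rw [hz]; push_cast
    exact pow_le_pow_right₀ hy1 (by norm_num)
  have h112 : (1 : ℝ) ≤ (y : ℝ) ^ 12 := one_le_pow₀ hy1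
  linarith

theorem card_prime_pair_le_one_of_odd {h : ℕ} (hh : ¬ 2 ∣ h) (x : ℕ) :
    ((Finset.range x).filter fun n => n.Prime ∧ (n + h).Prime).card ≤ 1 := by
  have : ((Finset.range x).filter fun n => n.Prime ∧ (n + h).Prime) ⊆ {2} := by
    intro n hn
    simp only [Finset.mem_filter, Finset.mem_singleton] at hn ⊢
    obtain ⟨-, hn, hnh⟩ := hn
    rcases hn.eq_two_or_odd with h2 | h2
    · exact h2
    · have := hn.two_le
      rcases hnh.eq_two_or_odd with h3 | h3 <;> lia
  simpa using Finset.card_le_card this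

theorem one_le_sum_divisors_inv {h : ℕ} (h0 : h ≠ 0) : 1 ≤ ∑ d ∈ h.divisors, 1 / (d : ℝ) := by
  have := Finset.single_le_sum (f := fun d : ℕ => 1 / (d : ℝ)) (fun _ _ => by positivity)
    (Nat.one_mem_divisors.2 h0)
  simpa using this

theorem exists_pow_le_and_log_le {x : ℕ} (hx : 2 ^ 24 ≤ x) :
    ∃ y : ℕ, 2 ≤ y ∧ y ^ 24 ≤ x ∧ Real.log x ≤ 48 * Real.log y := by
  obtain ⟨y, hy⟩ : ∃ y, y = Nat.findGreatest (fun y => y ^ 24 ≤ x) x := ⟨_, rfl⟩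
  have hy2 : 2 ≤ y := hy ▸ Nat.le_findGreatest (by lia) hx
  have hyx : y ^ 24 ≤ x := by
    rw [hy]
    exact Nat.findGreatest_spec (P := fun y => y ^ 24 ≤ x) (m := 2) (by lia) hx
  have hyx' : x < (y + 1) ^ 24 := by
    by_contra! hcon
    have h1 : y + 1 ≤ x := (Nat.le_self_pow (by norm_num) _).trans hcon
    have := Nat.le_findGreatest (P := fun y => y ^ 24 ≤ x) h1 hcon
    lia
  refine ⟨y, hy2, hyx, ?_⟩
  have h1 : x ≤ y ^ 48 := by
    calc x ≤ (y + 1) ^ 24 := hyx'.le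
      _ ≤ (y ^ 2) ^ 24 := Nat.pow_le_pow_left (by nlinarith) 24
      _ = y ^ 48 := by ring
  calc Real.log x ≤ Real.log ((y ^ 48 : ℕ) : ℝ) :=
        Real.log_le_log (by exact_mod_cast (by lia : 0 < x)) (by exact_mod_cast h1)
    _ = 48 * Real.log y := by push_cast; rw [Real.log_pow]; norm_num

theorem card_prime_pair_le {h x : ℕ} (h0 : h ≠ 0) (hx : 2 ^ 24 ≤ x) :
    (((Finset.range x).filter fun n => n.Prime ∧ (n + h).Prime).card : ℝ) ≤
      16128 * x * (∑ d ∈ h.divisors, 1 / (d : ℝ)) / Real.log x ^ 2 := by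
  obtain ⟨y, hy2, hyx, hlog⟩ := exists_pow_le_and_log_le hx
  have hB := one_le_sum_divisors_inv h0
  set B := ∑ d ∈ h.divisors, 1 / (d : ℝ)
  have hy1 : (1 : ℝ) ≤ y := by exact_mod_cast (by lia : 1 ≤ y)
  have hL : 0 < Real.log y := Real.log_pos (by exact_mod_cast hy2)
  have hLx : 0 < Real.log x := Real.log_pos (by exact_mod_cast (by lia : 1 < x))
  have hLy : Real.log y ≤ y := (Real.log_le_sub_one_of_pos (by linarith)).trans (by linarith)
  have hyx' : (y : ℝ) ^ 24 ≤ x := by exact_mod_cast hyx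
  have herr : (y : ℝ) ^ 12 ≤ x * B / Real.log y ^ 2 := by
    rw [le_div_iff₀ (by positivity)]
    calc (y : ℝ) ^ 12 * Real.log y ^ 2 ≤ (y : ℝ) ^ 12 * (y : ℝ) ^ 12 := by
          gcongr
          exact (pow_le_pow_left₀ hL.le hLy 2).trans (pow_le_pow_right₀ hy1 (by norm_num))
      _ = (y : ℝ) ^ 24 := by ring
      _ ≤ x := hyx'
      _ ≤ x * B := le_mul_of_one_le_right (Nat.cast_nonneg x) hB
  have hmain : (((Finset.range x).filter fun n => n.Prime ∧ (n + h).Prime).card : ℝ) ≤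
      7 * (x * B / Real.log y ^ 2) := by
    by_cases hh : 2 ∣ h
    · have := card_prime_pair_le_of_even hh h0 x hy2
      rw [mul_assoc, mul_div_assoc] at this
      linarith
    · have h1 : (((Finset.range x).filter fun n => n.Prime ∧ (n + h).Prime).card : ℝ) ≤ 1 := by
        exact_mod_cast card_prime_pair_le_one_of_odd hh x
      have h2 : (1 : ℝ) ≤ (y : ℝ) ^ 12 := one_le_pow₀ hy1
      linarith
  refine hmain.trans ?_
  rw [← mul_div_assoc, div_le_div_iff₀ (by positivity) (by positivity)]
  calc 7 * (x * B) * Real.log x ^ 2 ≤ 7 * (x * B) * (48 * Real.log y) ^ 2 := by gcongr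
    _ = 16128 * x * B * Real.log y ^ 2 := by ring

theorem sum_Icc_inv_mul_sqrt_le_three (n : ℕ) :
    ∑ d ∈ Finset.Icc 1 n, 1 / ((d : ℝ) * √d) ≤ 3 := by
  rcases Nat.eq_zero_or_pos n with rfl | hn
  · simp
  have : ∑ d ∈ Finset.Icc 1 n, 1 / ((d : ℝ) * √d) ≤ 3 - 2 / √n := by
    induction n, hn using Nat.le_induction with
    | base => norm_num
    | succ n hn ih =>
      rw [Finset.sum_Icc_succ_top (by lia)]
      have hn' : (0 : ℝ) < n := by exact_mod_cast hn
      have ha : 0 < √(n : ℝ) := Real.sqrt_pos.2 hn'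
      have hab : √(n : ℝ) ≤ √((n + 1 : ℕ) : ℝ) := Real.sqrt_le_sqrt (by push_cast; linarith)
      have ha2 : √(n : ℝ) ^ 2 = n := Real.sq_sqrt hn'.le
      have hb2 : √((n + 1 : ℕ) : ℝ) ^ 2 = ((n + 1 : ℕ) : ℝ) := Real.sq_sqrt (Nat.cast_nonneg _)
      rw [← hb2]
      rw [Real.sqrt_sq (Real.sqrt_nonneg _)]
      have hdiff : √((n + 1 : ℕ) : ℝ) ^ 2 - √(n : ℝ) ^ 2 = 1 := by
        rw [ha2, hb2]; push_cast; ring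
      generalize √(n : ℝ) = a at *
      generalize √((n + 1 : ℕ) : ℝ) = b at *
      have hb : 0 < b := ha.trans_le hab
      have : 1 / (b ^ 2 * b) ≤ 2 / a - 2 / b := by
        rw [div_sub_div _ _ ha.ne' hb.ne', div_le_div_iff₀ (by positivity) (by positivity)]
        have h1 : (2 * b - a * 2) * (a + b) = 2 := by linear_combination 2 * hdiff
        have h2 : a * (a + b) ≤ 2 * b ^ 2 := by nlinarith
        have h3 : 0 < a + b := by positivity
        refine le_of_mul_le_mul_right ?_ h3
        calc 1 * (a * b) * (a + b) = b * (a * (a + b)) := by ring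
          _ ≤ b * (2 * b ^ 2) := by gcongr
          _ = (2 * b - a * 2) * (a + b) * (b ^ 2 * b) := by rw [h1]; ring
          _ = (2 * b - a * 2) * (b ^ 2 * b) * (a + b) := by ring
      linarith
  have h2 : 0 ≤ 2 / √(n : ℝ) := by positivity
  linarith

theorem sum_sq_sum_divisors_inv_le (x : ℕ) :
    ∑ h ∈ Finset.Icc 1 x, (∑ d ∈ h.divisors, 1 / (d : ℝ)) ^ 2 ≤ 9 * x := by
  have hsq : ∀ h ∈ Finset.Icc 1 x, (∑ d ∈ h.divisors, 1 / (d : ℝ)) ^ 2 ≤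
      3 * ∑ d ∈ h.divisors, 1 / √(d : ℝ) := by
    intro h hh
    rw [Finset.mem_Icc] at hh
    refine (Finset.sum_sq_le_sum_mul_sum_of_sq_le_mul h.divisors
      (f := fun d : ℕ => 1 / ((d : ℝ) * √d)) (g := fun d : ℕ => 1 / √(d : ℝ))
      (fun _ _ => by positivity) (fun _ _ => by positivity) ?_).trans ?_
    · intro d _
      refine le_of_eq ?_
      rw [one_div_mul_one_div, mul_assoc, Real.mul_self_sqrt (Nat.cast_nonneg d), one_div_pow,
        pow_two]
    · refine mul_le_mul_of_nonneg_right (le_trans ?_ (sum_Icc_inv_mul_sqrt_le_three h))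
        (Finset.sum_nonneg fun _ _ => by positivity)
      refine Finset.sum_le_sum_of_subset_of_nonneg ?_ fun _ _ _ => by positivity
      intro d hd
      exact Finset.mem_Icc.2 ⟨Nat.pos_of_mem_divisors hd, Nat.divisor_le hd⟩
  have hcomm : ∑ h ∈ Finset.Icc 1 x, ∑ d ∈ h.divisors, 1 / √(d : ℝ) =
      ∑ d ∈ Finset.Icc 1 x, ∑ h ∈ (Finset.Icc 1 x).filter (d ∣ ·), 1 / √(d : ℝ) := by
    refine Finset.sum_comm' fun h d => ?_
    simp only [Finset.mem_Icc, Nat.mem_divisors, Finset.mem_filter]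
    constructor
    · rintro ⟨⟨h1, h2⟩, h3, h4⟩
      exact ⟨⟨⟨h1, h2⟩, h3⟩, Nat.pos_of_dvd_of_pos h3 h1, (Nat.le_of_dvd h1 h3).trans h2⟩
    · rintro ⟨⟨⟨h1, h2⟩, h3⟩, h4⟩
      exact ⟨⟨h1, h2⟩, h3, by lia⟩
  calc ∑ h ∈ Finset.Icc 1 x, (∑ d ∈ h.divisors, 1 / (d : ℝ)) ^ 2
      ≤ ∑ h ∈ Finset.Icc 1 x, 3 * ∑ d ∈ h.divisors, 1 / √(d : ℝ) := Finset.sum_le_sum hsq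
    _ = 3 * ∑ d ∈ Finset.Icc 1 x, ∑ h ∈ (Finset.Icc 1 x).filter (d ∣ ·), 1 / √(d : ℝ) := by
        rw [← Finset.mul_sum, hcomm]
    _ ≤ 3 * ∑ d ∈ Finset.Icc 1 x, x * (1 / ((d : ℝ) * √d)) := by
        gcongr with d hd
        have hcard : (((Finset.Icc 1 x).filter (d ∣ ·)).card : ℝ) ≤ x / d := by
          have : (Finset.Icc 1 x).filter (d ∣ ·) = (Finset.Ioc 0 x).filter (d ∣ ·) := rfl
          rw [this, Nat.Ioc_filter_dvd_card_eq_div]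
          exact Nat.cast_div_le
        rw [Finset.sum_const, nsmul_eq_mul]
        calc _ ≤ (x : ℝ) / d * (1 / √d) := by gcongr
          _ = x * (1 / ((d : ℝ) * √d)) := by rw [div_mul_div_comm, mul_one_div, mul_one]
    _ ≤ 3 * (x * 3) := by
        rw [← Finset.mul_sum]
        gcongr
        exact sum_Icc_inv_mul_sqrt_le_three x
    _ = 9 * x := by ring

theorem sum_sq_card_prime_pair_le {x : ℕ} (hx : 2 ^ 24 ≤ x) :
    ∑ h ∈ Finset.Icc 1 x,
        (((Finset.range x).filter fun n => n.Prime ∧ (n + h).Prime).card : ℝ) ^ 2 ≤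
      9 * 16128 ^ 2 * x ^ 3 / Real.log x ^ 4 := by
  calc ∑ h ∈ Finset.Icc 1 x,
        (((Finset.range x).filter fun n => n.Prime ∧ (n + h).Prime).card : ℝ) ^ 2
      ≤ ∑ h ∈ Finset.Icc 1 x,
          (16128 * x * (∑ d ∈ h.divisors, 1 / (d : ℝ)) / Real.log x ^ 2) ^ 2 := by
        refine Finset.sum_le_sum fun h hh => pow_le_pow_left₀ (Nat.cast_nonneg _) ?_ 2
        exact card_prime_pair_le (by rw [Finset.mem_Icc] at hh; lia) hx
    _ = 16128 ^ 2 * x ^ 2 / Real.log x ^ 4 *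
          ∑ h ∈ Finset.Icc 1 x, (∑ d ∈ h.divisors, 1 / (d : ℝ)) ^ 2 := by
        rw [Finset.mul_sum]
        refine Finset.sum_congr rfl fun h _ => ?_
        rw [div_pow]
        ring
    _ ≤ 16128 ^ 2 * x ^ 2 / Real.log x ^ 4 * (9 * x) := by
        gcongr
        exact sum_sq_sum_divisors_inv_le x
    _ = 9 * 16128 ^ 2 * x ^ 3 / Real.log x ^ 4 := by ring

theorem strictMonoOn_nthPrime : StrictMonoOn nthPrime (Set.Ici 1) := by
  intro i hi j hj hij
  simp only [Set.mem_Ici] at hi hj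
  exact Nat.nth_strictMono Nat.infinite_setOfPred_prime (by lia)

theorem prime_nthPrime (n : ℕ) : (nthPrime n).Prime := Nat.prime_nth_prime _

theorem diffCard_nthPrime_le {N : ℕ} (hN : 1 ≤ N) : diffCard nthPrime N ≤ 3 * nthPrime N := by
  have hmono : ∀ i ∈ Finset.Icc 1 N, nthPrime i ≤ nthPrime N := fun i hi =>
    strictMonoOn_nthPrime.monotoneOn (Finset.mem_Icc.1 hi).1 hN (Finset.mem_Icc.1 hi).2
  have hsub : ((Finset.Icc 1 N) ×ˢ (Finset.Icc 1 N)).image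
      (fun p : ℕ × ℕ => (nthPrime p.1 : ℤ) - (nthPrime p.2 : ℤ)) ⊆
      Finset.Icc (-(nthPrime N : ℤ)) (nthPrime N) := by
    refine Finset.image_subset_iff.2 ?_
    rintro ⟨i, j⟩ hij
    rw [Finset.mem_product] at hij
    have h1 := hmono i hij.1
    have h2 := hmono j hij.2
    simp only [Finset.mem_Icc]
    lia
  have := Finset.card_le_card hsub
  rw [Int.card_Icc] at this
  have := (prime_nthPrime N).one_le
  unfold diffCard
  lia

theorem exists_differences_subset {N : ℕ} (hN : 3 ≤ N) :
    ∃ D ⊆ Finset.Icc 1 (nthPrime N), D.card ≤ diffCard nthPrime N ∧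
      N ^ 2 ≤ 9 * ∑ h ∈ D,
        ((Finset.range (nthPrime N)).filter fun n => n.Prime ∧ (n + h).Prime).card := by
  obtain ⟨M, hM1, hM2⟩ : ∃ M, N ≤ 3 * M ∧ N ≤ 3 * (N - M) := ⟨N / 2, by lia, by lia⟩
  have hmem : ∀ p ∈ Finset.Icc 1 M ×ˢ Finset.Icc (M + 1) N,
      1 ≤ p.1 ∧ p.1 < p.2 ∧ p.2 ≤ N := by
    intro p hp
    simp only [Finset.mem_product, Finset.mem_Icc] at hp
    lia
  have hlt : ∀ p ∈ Finset.Icc 1 M ×ˢ Finset.Icc (M + 1) N,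
      nthPrime p.1 < nthPrime p.2 ∧ nthPrime p.2 ≤ nthPrime N := by
    intro p hp
    obtain ⟨h1, h2, h3⟩ := hmem p hp
    exact ⟨strictMonoOn_nthPrime h1 (h1.trans h2.le) h2,
      strictMonoOn_nthPrime.monotoneOn (h1.trans h2.le) ((h1.trans h2.le).trans h3) h3⟩
  have hcard : (Finset.Icc 1 M ×ˢ Finset.Icc (M + 1) N).card = M * (N - M) := by
    rw [Finset.card_product, Nat.card_Icc, Nat.card_Icc]
    congr 1
    lia
  generalize Finset.Icc 1 M ×ˢ Finset.Icc (M + 1) N = Q at *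
  refine ⟨Q.image fun p => nthPrime p.2 - nthPrime p.1, ?_, ?_, ?_⟩
  · refine Finset.image_subset_iff.2 fun p hp => ?_
    have := hlt p hp
    rw [Finset.mem_Icc]
    lia
  · refine Finset.card_le_card_of_injOn (fun h => (h : ℤ)) ?_ fun _ _ _ _ h => Int.ofNat_inj.1 h
    intro h hh
    rw [Finset.mem_coe, Finset.mem_image] at hh
    obtain ⟨p, hp, rfl⟩ := hh
    obtain ⟨h1, h2, h3⟩ := hmem p hp
    rw [Finset.mem_coe, Finset.mem_image]
    refine ⟨p.swap, ?_, ?_⟩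
    · simp only [Finset.mem_product, Finset.mem_Icc, Prod.fst_swap, Prod.snd_swap]
      lia
    · simp only [Prod.fst_swap, Prod.snd_swap]
      rw [Nat.cast_sub (hlt p hp).1.le]
  · have hsq : N * N ≤ (3 * M) * (3 * (N - M)) := Nat.mul_le_mul hM1 hM2
    calc N ^ 2 ≤ 9 * Q.card := by rw [hcard]; nlinarith
      _ ≤ _ := Nat.mul_le_mul_left 9 ?_
    rw [Finset.card_eq_sum_card_image (fun p => nthPrime p.2 - nthPrime p.1) Q]
    refine Finset.sum_le_sum fun h _ =>
      Finset.card_le_card_of_injOn (fun p => nthPrime p.1) ?_ ?_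
    · intro p hp
      rw [Finset.mem_coe, Finset.mem_filter] at hp
      have h1 := hlt p hp.1
      have h2 : nthPrime p.1 + h = nthPrime p.2 := by lia
      rw [Finset.mem_coe, Finset.mem_filter, Finset.mem_range, h2]
      exact ⟨by lia, prime_nthPrime _, prime_nthPrime _⟩
    · intro p hp q hq hpq
      rw [Finset.mem_coe, Finset.mem_filter] at hp hq
      dsimp only at hpq
      have h1 := hlt p hp.1
      have h2 := hlt q hq.1
      obtain ⟨hp1, hp2, -⟩ := hmem p hp.1
      obtain ⟨hq1, hq2, -⟩ := hmem q hq.1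
      exact Prod.ext (strictMonoOn_nthPrime.injOn hp1 hq1 hpq)
        (strictMonoOn_nthPrime.injOn (hp1.trans hp2.le) (hq1.trans hq2.le) (by lia))

theorem pow_four_mul_log_pow_four_le {N : ℕ} (hN : 3 ≤ N) (hx : 2 ^ 24 ≤ nthPrime N) :
    (N : ℝ) ^ 4 * Real.log (nthPrime N) ^ 4 ≤
      81 * 9 * 16128 ^ 2 * nthPrime N ^ 3 * diffCard nthPrime N := by
  obtain ⟨D, hDIcc, hDcard, hsum⟩ := exists_differences_subset hN
  have henergy := sum_sq_card_prime_pair_le hx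
  have hlog : 0 < Real.log (nthPrime N) := Real.log_pos (by exact_mod_cast (by lia))
  generalize nthPrime N = x at *
  generalize diffCard nthPrime N = C at *
  set r : ℕ → ℝ := fun h => ((Finset.range x).filter fun n => n.Prime ∧ (n + h).Prime).card
  have hsum' : (N : ℝ) ^ 2 ≤ 9 * ∑ h ∈ D, r h := by
    have h1 := (Nat.cast_le (α := ℝ)).2 hsum
    rw [Nat.cast_pow, Nat.cast_mul, Nat.cast_sum] at h1
    exact h1
  have hsq : ((N : ℝ) ^ 2) ^ 2 ≤ 81 * (C * (9 * 16128 ^ 2 * x ^ 3 / Real.log x ^ 4)) := by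
    calc ((N : ℝ) ^ 2) ^ 2 ≤ (9 * ∑ h ∈ D, r h) ^ 2 := pow_le_pow_left₀ (by positivity) hsum' 2
      _ = 81 * (∑ h ∈ D, r h) ^ 2 := by ring
      _ ≤ 81 * (D.card * ∑ h ∈ D, r h ^ 2) :=
          mul_le_mul_of_nonneg_left sq_sum_le_card_mul_sum_sq (by norm_num)
      _ ≤ 81 * (C * (9 * 16128 ^ 2 * x ^ 3 / Real.log x ^ 4)) := by
          refine mul_le_mul_of_nonneg_left (mul_le_mul (Nat.cast_le.2 hDcard) ?_
            (Finset.sum_nonneg fun _ _ => sq_nonneg _) (Nat.cast_nonneg C)) (by norm_num)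
          exact (Finset.sum_le_sum_of_subset_of_nonneg hDIcc fun _ _ _ => sq_nonneg _).trans henergy
  rw [← mul_div_assoc, ← mul_div_assoc, le_div_iff₀ (by positivity)] at hsq
  calc (N : ℝ) ^ 4 * Real.log x ^ 4 = ((N : ℝ) ^ 2) ^ 2 * Real.log x ^ 4 := by ring
    _ ≤ 81 * (C * (9 * 16128 ^ 2 * (x : ℝ) ^ 3)) := hsq
    _ = 81 * 9 * 16128 ^ 2 * (x : ℝ) ^ 3 * C := by ring

theorem primeCounting_nthPrime {N : ℕ} (hN : 1 ≤ N) : Nat.primeCounting (nthPrime N) = N := by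
  rw [nthPrime, Nat.primeCounting, Nat.primeCounting', Nat.count_succ,
    Nat.count_nth_of_infinite Nat.infinite_setOfPred_prime, if_pos (Nat.prime_nth_prime _)]
  lia

theorem le_two_mul_mul_log_nthPrime {N : ℕ} (hN : 1 ≤ N) (hx : 2 ^ 24 ≤ nthPrime N) :
    (nthPrime N : ℝ) ≤ 2 * (N * Real.log (nthPrime N)) ∧
      Real.log (nthPrime N) ≤ 2 * Real.log N := by
  have hpi := Chebyshev.pi_ge (nthPrime N)
  rw [primeCounting_nthPrime hN] at hpi
  have hx' : (2 : ℝ) ^ 24 ≤ nthPrime N := by exact_mod_cast hx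
  generalize (nthPrime N : ℝ) = x at *
  have hN' : (1 : ℝ) ≤ N := by exact_mod_cast hN
  have hx0 : 0 < x := by linarith
  obtain ⟨t, ht⟩ : ∃ t, t = √√x := ⟨_, rfl⟩
  have htx : t ^ 4 = x := by
    rw [ht, show √√x ^ 4 = (√√x ^ 2) ^ 2 by ring, Real.sq_sqrt (Real.sqrt_nonneg _),
      Real.sq_sqrt hx0.le]
  have ht64 : 64 ≤ t := by
    refine le_of_pow_le_pow_left₀ (n := 4) (by norm_num) (ht ▸ Real.sqrt_nonneg _) ?_
    rw [htx]
    linarith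
  have hlogt : Real.log x ≤ 4 * t := by
    rw [← htx, Real.log_pow]
    have := Real.log_le_sub_one_of_pos (by linarith : 0 < t)
    push_cast
    linarith
  have hlogx : 0 < Real.log x := Real.log_pos (by linarith)
  have hlog1 : Real.log (x + 1) ≤ Real.log x + 1 := by
    have h1 : Real.log (x + 1) ≤ Real.log (x * 2) := Real.log_le_log (by linarith) (by linarith)
    rw [Real.log_mul hx0.ne' (by norm_num)] at h1
    linarith [Real.log_two_lt_d9]
  have ht2 : 4096 ≤ t ^ 2 := by nlinarith
  have ht3 : 4096 * t ≤ t ^ 3 := by nlinarith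
  have ht4 : 64 * t ^ 3 ≤ t ^ 4 := by nlinarith [pow_pos (by linarith : 0 < t) 3]
  have hfirst : x ≤ 2 * (N * Real.log x) := by
    rw [div_le_iff₀ hlogx] at hpi
    nlinarith [Real.log_two_gt_d9]
  refine ⟨hfirst, ?_⟩
  have hNt : t ^ 2 ≤ N := by
    have h1 : t ^ 4 ≤ 8 * N * t := by
      rw [htx]
      nlinarith
    have h2 : t ^ 3 ≤ 8 * N := by
      refine le_of_mul_le_mul_right ?_ (by linarith : 0 < t)
      linarith
    nlinarith
  have h3 : x ≤ (N : ℝ) ^ 2 := by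
    rw [← htx, show t ^ 4 = (t ^ 2) ^ 2 by ring]
    exact pow_le_pow_left₀ (by positivity) hNt 2
  calc Real.log x ≤ Real.log ((N : ℝ) ^ 2) := Real.log_le_log hx0 h3
    _ = 2 * Real.log N := by rw [Real.log_pow]; norm_num

theorem stmt19 :
    ∃ c₁ : ℝ, 0 < c₁ ∧ ∃ c₂ : ℝ, 0 < c₂ ∧ ∃ N₀ : ℕ, ∀ N ≥ N₀,
      c₁ * (N : ℝ) * Real.log N ≤ (diffCard nthPrime N : ℝ) ∧
        (diffCard nthPrime N : ℝ) ≤ c₂ * (N : ℝ) * Real.log N := by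
  refine ⟨1 / (8 * (81 * 9 * 16128 ^ 2)), by norm_num, 12, by norm_num, 2 ^ 24, fun N hN => ?_⟩
  have hNx : N ≤ nthPrime N := by
    have := Nat.add_two_le_nth_prime (N - 1)
    unfold nthPrime
    lia
  have hx : 2 ^ 24 ≤ nthPrime N := hN.le.trans hNx
  obtain ⟨h1, h2⟩ := le_two_mul_mul_log_nthPrime (by lia) hx
  have h3 := pow_four_mul_log_pow_four_le (by lia) hx
  have h4 : (diffCard nthPrime N : ℝ) ≤ 3 * nthPrime N := by
    exact_mod_cast diffCard_nthPrime_le (by lia)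
  have hN0 : (0 : ℝ) < N := by exact_mod_cast (by lia : 0 < N)
  have hNx' : (N : ℝ) ≤ nthPrime N := by exact_mod_cast hNx
  have hlogN : Real.log N ≤ Real.log (nthPrime N) := Real.log_le_log hN0 hNx'
  have hlogN0 : 0 ≤ Real.log N := Real.log_natCast_nonneg N
  generalize (nthPrime N : ℝ) = x at *
  generalize (diffCard nthPrime N : ℝ) = C at *
  have hx0 : 0 < x := hN0.trans_le hNx'
  constructor
  · have hcube : x ^ 3 ≤ 8 * (N * Real.log x) ^ 3 := by
      calc x ^ 3 ≤ (2 * (N * Real.log x)) ^ 3 := pow_le_pow_left₀ hx0.le h1 3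
        _ = _ := by ring
    have hlow : N * Real.log x ≤ 8 * (81 * 9 * 16128 ^ 2) * C := by
      refine le_of_mul_le_mul_right ?_ (pow_pos hx0 3)
      calc N * Real.log x * x ^ 3 ≤ N * Real.log x * (8 * (N * Real.log x) ^ 3) := by
            gcongr
            exact mul_nonneg hN0.le (hlogN0.trans hlogN)
        _ = 8 * ((N : ℝ) ^ 4 * Real.log x ^ 4) := by ring
        _ ≤ 8 * (81 * 9 * 16128 ^ 2 * x ^ 3 * C) := by gcongr
        _ = _ := by ring
    have : (N : ℝ) * Real.log N ≤ N * Real.log x := by gcongr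
    rw [mul_assoc, one_div, inv_mul_le_iff₀ (by norm_num)]
    exact this.trans hlow
  · have : (N : ℝ) * Real.log x ≤ N * (2 * Real.log N) := by gcongr
    linarith
end
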